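/- Fix b > 0 with b² < W(2/e), and let m : ℕ → ℕ be any sequence with m(n)/n^{3/2} → b/2 as n → ∞. Then lim_{n→∞} n^{-3/2}·log P_{m(n)}( X = 0 ) = −b³/6; equivalently, the number T(n, m(n)) of triangle-free labeled graphs on n vertices with m(n) edges satisfies T(n,m(n)) = C( C(n,2), m(n) ) · exp( −(4/3)·(m(n)/n)³ + o(n^{3/2}) ). -/

import Mathlib

open Filter
open scoped BigOperators symmDiff Classical

noncomputable section

/-- Number of edges of a labeled simple graph on `Fin n`. -/
def edgeCount {n : ℕ} (G : SimpleGraph (Fin n)) : ℕ := Nat.card G.edgeSet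

/-- Number of triangles of a labeled simple graph on `Fin n`. -/
def triCount {n : ℕ} (G : SimpleGraph (Fin n)) : ℕ :=
  Nat.card {s : Finset (Fin n) // G.IsNClique 3 s}

/-- Probability of the event `A` under the Erdős–Rényi random graph `G(n,p)`. -/
def erProb (n : ℕ) (p : ℝ) (A : Set (SimpleGraph (Fin n))) : ℝ :=
  ∑ G : SimpleGraph (Fin n),
    if G ∈ A then p ^ edgeCount G * (1 - p) ^ (n.choose 2 - edgeCount G) else 0

/-- Conditional probability `P_p(A | B)` for `G(n,p)`. -/
def erCondProb (n : ℕ) (p : ℝ) (A B : Set (SimpleGraph (Fin n))) : ℝ :=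
  erProb n p (A ∩ B) / erProb n p B

/-- Probability of the event `A` under the uniform random graph `G(n,m)`. -/
def gnmProb (n m : ℕ) (A : Set (SimpleGraph (Fin n))) : ℝ :=
  (Nat.card {G : SimpleGraph (Fin n) // edgeCount G = m ∧ G ∈ A} : ℝ) /
    ((n.choose 2).choose m : ℝ)

/-- Expected number of triangles of `G(n,m)`. -/
def gnmExpTri (n m : ℕ) : ℝ :=
  (∑ G : SimpleGraph (Fin n), if edgeCount G = m then (triCount G : ℝ) else 0) /
    ((n.choose 2).choose m : ℝ)

/-- Gibbs weight `λ^{|G|} (1-ζ)^{X(G)}`. -/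
def gibbsWeight {n : ℕ} (lam zeta : ℝ) (G : SimpleGraph (Fin n)) : ℝ :=
  lam ^ edgeCount G * (1 - zeta) ^ triCount G

/-- The partition function `Z(λ,ζ)`. -/
def Zfun (n : ℕ) (lam zeta : ℝ) : ℝ := ∑ G : SimpleGraph (Fin n), gibbsWeight lam zeta G

/-- Probability of the event `A` under the Gibbs measure `μ_{λ,ζ}`. -/
def gibbsProb (n : ℕ) (lam zeta : ℝ) (A : Set (SimpleGraph (Fin n))) : ℝ :=
  (∑ G : SimpleGraph (Fin n), if G ∈ A then gibbsWeight lam zeta G else 0) / Zfun n lam zeta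

/-- Expectation of `f` under the Gibbs measure `μ_{λ,ζ}`. -/
def gibbsExp (n : ℕ) (lam zeta : ℝ) (f : SimpleGraph (Fin n) → ℝ) : ℝ :=
  (∑ G : SimpleGraph (Fin n), f G * gibbsWeight lam zeta G) / Zfun n lam zeta

/-- Number of edges of `H` with both endpoints in `S`. -/
def edgesIn {V : Type*} (H : SimpleGraph V) (S : Finset V) : ℕ :=
  Nat.card {e : Sym2 V // e ∈ H.edgeSet ∧ ∀ v ∈ e, v ∈ S}

/-- Weight `λ^{|S|} (1-ζ)^{|E(S)|}` of the measure `ν_{H,λ,ζ}`. -/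
def nuWeight {V : Type*} (H : SimpleGraph V) (lam zeta : ℝ) (S : Finset V) : ℝ :=
  lam ^ S.card * (1 - zeta) ^ edgesIn H S

/-- The partition function `Ξ_H(λ,ζ)`. -/
def XiFun {V : Type*} [Fintype V] (H : SimpleGraph V) (lam zeta : ℝ) : ℝ :=
  ∑ S : Finset V, nuWeight H lam zeta S

/-- The probability of `S` under `ν_{H,λ,ζ}`. -/
def nuProb {V : Type*} [Fintype V] (H : SimpleGraph V) (lam zeta : ℝ) (S : Finset V) : ℝ :=
  nuWeight H lam zeta S / XiFun H lam zeta

/-- `W` is the Lambert-W function on `[0,∞)`: for `x ≥ 0`, `W x` is the unique `w ≥ 0`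
with `w·e^w = x`. -/
def IsLambertW (W : ℝ → ℝ) : Prop :=
  ∀ x : ℝ, 0 ≤ x → (0 ≤ W x ∧ W x * Real.exp (W x) = x ∧
    ∀ w : ℝ, 0 ≤ w → w * Real.exp w = x → w = W x)

/-- `η* = (W(2/e)/(2/e))^{3/2}`. -/
def etaStar (W : ℝ → ℝ) : ℝ := (W (2 / Real.exp 1) / (2 / Real.exp 1)) ^ ((3 : ℝ) / 2)

/-- The condition `c < c̄(η)` where `c̄(η) = 1/√(e(1−η/η*))` for `η < η*` and `+∞` otherwise. -/
def LtCbar (W : ℝ → ℝ) (c η : ℝ) : Prop :=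
  η < etaStar W → c < 1 / Real.sqrt (Real.exp 1 * (1 - η / etaStar W))

/-- The left-hand side of the equation defining `ζ(c,η)`, interpreted as `1` at `ζ = 0`. -/
def zetaLHS (W : ℝ → ℝ) (c zeta : ℝ) : ℝ :=
  (1 - zeta) * (if zeta = 0 then 1 else
    (W (2 * zeta * c ^ 2) / (2 * zeta * c ^ 2)) ^ ((3 : ℝ) / 2))



/-- `T(n,m)`: the number of triangle-free labeled graphs on `n` vertices with `m` edges. -/
def triFreeCount (n m : ℕ) : ℕ :=
  Nat.card {G : SimpleGraph (Fin n) // edgeCount G = m ∧ triCount G = 0}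

section LinearHypergraph

variable {α : Type} [DecidableEq α]

/-- `T` is a 3-uniform linear hypergraph whose degrees lie between `n - 2` and `n`. -/
structure NearRegularLinear (n : ℕ) (T : Finset (Finset α)) : Prop where
  card_eq : ∀ t ∈ T, t.card = 3
  linear : ∀ t ∈ T, ∀ s ∈ T, ∀ a b : α, a ≠ b → a ∈ t → b ∈ t → a ∈ s → b ∈ s → t = s
  deg_le : ∀ e : α, (T.filter (e ∈ ·)).card ≤ n
  le_deg : ∀ e : α, n ≤ (T.filter (e ∈ ·)).card + 2

/-- `A` consists of members of `T` and contains all those that avoid `O`. -/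
def IsCompleteOff (T : Finset (Finset α)) (O : Finset α) (A : Finset (Finset α)) : Prop :=
  A ⊆ T ∧ ∀ t ∈ T, Disjoint t O → t ∈ A

lemma IsCompleteOff.insert_of_subset {T : Finset (Finset α)} {O : Finset α}
    {A B : Finset (Finset α)} (hA : IsCompleteOff T O A) {e : α} (h1 : {t ∈ A | e ∉ t} ⊆ B)
    (h2 : B ⊆ A) :
    IsCompleteOff T (insert e O) B := by
  refine ⟨h2.trans hA.1, fun t ht hd => h1 ?_⟩
  rw [Finset.disjoint_insert_right] at hd
  exact Finset.mem_filter.mpr ⟨hA.2 t ht hd.2, hd.1⟩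

lemma IsCompleteOff.insert_right {T : Finset (Finset α)} {O : Finset α} {A : Finset (Finset α)}
    (hA : IsCompleteOff T O A) (e : α) : IsCompleteOff T (insert e O) A :=
  hA.insert_of_subset (Finset.filter_subset _ _) subset_rfl

lemma exists_triple {t : Finset α} (ht : t.card = 3) {e : α} (he : e ∈ t) :
    ∃ f g, f ≠ e ∧ g ≠ e ∧ f ≠ g ∧ t = {e, f, g} := by
  have h2 : (t.erase e).card = 2 := by rw [Finset.card_erase_of_mem he, ht]
  obtain ⟨f, g, hfg, h⟩ := Finset.card_eq_two.mp h2
  have hf : f ∈ t.erase e := by rw [h]; simp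
  have hg : g ∈ t.erase e := by rw [h]; simp
  refine ⟨f, g, (Finset.mem_erase.mp hf).1, (Finset.mem_erase.mp hg).1, hfg, ?_⟩
  rw [← Finset.insert_erase he, h]

/-- For each element `e`, few members through `e` meet a given small set. -/
lemma NearRegularLinear.card_meet_le {n : ℕ} {T : Finset (Finset α)} (hT : NearRegularLinear n T)
    {O : Finset α} {e : α} (he : e ∉ O) :
    (T.filter fun t => e ∈ t ∧ ¬ Disjoint t O).card ≤ O.card := by
  refine Finset.card_le_card_of_forall_subsingleton (fun t a => a ∈ t) ?_ ?_
  · intro t ht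
    simp only [Finset.mem_filter, Finset.not_disjoint_iff] at ht
    obtain ⟨-, -, a, ha, haO⟩ := ht
    exact ⟨a, haO, ha⟩
  · intro a ha t ht s hs
    simp only [Set.mem_ofPred_eq, Finset.mem_filter] at ht hs
    exact hT.linear t ht.1.1 s hs.1.1 e a (fun h => he (h ▸ ha)) ht.1.2.1 ht.2 hs.1.2.1 hs.2

variable [Fintype α]

/-- The sum of `lam ^ #I` over all sets `I` disjoint from `O` such that `I ∪ O` contains no member
of `A`. -/
def indepSum (lam : ℝ) (O : Finset α) (A : Finset (Finset α)) : ℝ :=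
  ∑ I : Finset α with Disjoint I O ∧ ∀ t ∈ A, ¬ t ⊆ I ∪ O, lam ^ I.card

lemma indepSum_nonneg {lam : ℝ} (hlam : 0 ≤ lam) (O : Finset α) (A : Finset (Finset α)) :
    0 ≤ indepSum lam O A :=
  Finset.sum_nonneg fun _ _ => pow_nonneg hlam _

lemma indepSum_anti {lam : ℝ} (hlam : 0 ≤ lam) (O : Finset α) {A B : Finset (Finset α)}
    (h : B ⊆ A) : indepSum lam O A ≤ indepSum lam O B := by
  unfold indepSum
  refine Finset.sum_le_sum_of_subset_of_nonneg ?_ fun _ _ _ => pow_nonneg hlam _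
  intro I hI
  simp only [Finset.mem_filter, Finset.mem_univ, true_and] at hI ⊢
  exact ⟨hI.1, fun t ht => hI.2 t (h ht)⟩

lemma indepSum_eq_zero (lam : ℝ) {O : Finset α} {A : Finset (Finset α)} {t : Finset α}
    (ht : t ∈ A) (htO : t ⊆ O) : indepSum lam O A = 0 := by
  unfold indepSum
  rw [Finset.filter_false_of_mem, Finset.sum_empty]
  rintro I - ⟨-, h⟩
  exact h t ht (htO.trans Finset.subset_union_right)

/-- The contribution of the sets containing `e`. -/
lemma sum_filter_mem_eq_mul_indepSum (lam : ℝ) {O : Finset α} (A : Finset (Finset α)) {e : α}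
    (he : e ∉ O) :
    ∑ I ∈ Finset.univ.filter (fun I : Finset α => Disjoint I O ∧ ∀ t ∈ A, ¬ t ⊆ I ∪ O) with e ∈ I,
      lam ^ I.card = lam * indepSum lam (insert e O) A := by
  unfold indepSum
  rw [Finset.mul_sum]
  symm
  refine Finset.sum_bij' (fun I _ => insert e I) (fun I _ => I.erase e) ?_ ?_ ?_ ?_ ?_
  · intro I hI
    simp only [Finset.mem_filter, Finset.mem_univ, true_and, Finset.disjoint_insert_right,
      Finset.disjoint_insert_left, Finset.mem_insert, true_or, and_true] at hI ⊢
    refine ⟨⟨he, hI.1.2⟩, fun t ht => ?_⟩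
    have := hI.2 t ht
    rwa [Finset.union_insert, ← Finset.insert_union] at this
  · intro I hI
    simp only [Finset.mem_filter, Finset.mem_univ, true_and, Finset.disjoint_insert_right,
      Finset.mem_erase] at hI ⊢
    refine ⟨⟨fun h => h.1 rfl, Finset.disjoint_of_subset_left (Finset.erase_subset _ _) hI.1.1⟩,
      fun t ht => ?_⟩
    have := hI.1.2 t ht
    rwa [Finset.union_insert, ← Finset.insert_union, Finset.insert_erase hI.2]
  · intro I hI
    simp only [Finset.mem_filter, Finset.mem_univ, true_and, Finset.disjoint_insert_right] at hI
    exact Finset.erase_insert hI.1.1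
  · intro I hI
    simp only [Finset.mem_filter] at hI
    exact Finset.insert_erase hI.2
  · intro I hI
    simp only [Finset.mem_filter, Finset.mem_univ, true_and, Finset.disjoint_insert_right] at hI
    rw [Finset.card_insert_of_notMem hI.1.1, pow_succ']

/-- Splitting according to whether `e` is occupied. -/
lemma indepSum_split (lam : ℝ) {O : Finset α} (A : Finset (Finset α)) {e : α} (he : e ∉ O) :
    indepSum lam O A = indepSum lam (insert e O) {t ∈ A | e ∉ t}
      + lam * indepSum lam (insert e O) A := by
  rw [indepSum, ← Finset.sum_filter_not_add_sum_filter _ (fun I => e ∈ I)]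
  congr 1
  · refine Finset.sum_congr ?_ fun _ _ => rfl
    ext I
    simp only [Finset.mem_filter, Finset.mem_univ, true_and, Finset.disjoint_insert_right]
    constructor
    · rintro ⟨⟨h1, h2⟩, h3⟩
      refine ⟨⟨h3, h1⟩, fun t ht hsub => h2 t ht.1 fun a ha => ?_⟩
      have := hsub ha
      simp only [Finset.mem_union, Finset.mem_insert] at this ⊢
      rcases this with h | rfl | h
      · exact Or.inl h
      · exact absurd ha ht.2
      · exact Or.inr h
    · rintro ⟨⟨h3, h1⟩, h2⟩
      refine ⟨⟨h1, fun t ht hsub => ?_⟩, h3⟩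
      by_cases het : e ∈ t
      · have := hsub het
        simp only [Finset.mem_union] at this
        tauto
      · refine h2 t ⟨ht, het⟩ (hsub.trans ?_)
        exact Finset.union_subset_union_right (Finset.subset_insert _ _)
  · exact sum_filter_mem_eq_mul_indepSum lam A he

lemma indepSum_sub_insert (lam : ℝ) {O : Finset α} (B : Finset (Finset α)) {t : Finset α} {g : α}
    (hg : g ∉ O) (hgt : g ∈ t) :
    indepSum lam O B - indepSum lam O (insert t B) =
      lam * (indepSum lam (insert g O) B - indepSum lam (insert g O) (insert t B)) := by
  rw [indepSum_split lam B hg, indepSum_split lam (insert t B) hg,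
    Finset.filter_insert, if_neg (not_not.mpr hgt)]
  ring

/-- Occupation probabilities are at most `M` after at most `k` elements have been fixed. -/
def OccupationLE (T : Finset (Finset α)) (lam : ℝ) (k : ℕ) (M : ℝ) : Prop :=
  ∀ O A, IsCompleteOff T O A → O.card ≤ k → ∀ e ∉ O,
    lam * indepSum lam (insert e O) A ≤ M * indepSum lam O A

/-- Occupation probabilities of elements that are not forced to be vacant are at least `M` after at
most `k` elements have been fixed. -/
def OccupationGE (T : Finset (Finset α)) (lam : ℝ) (k : ℕ) (M : ℝ) : Prop :=
  ∀ O A, IsCompleteOff T O A → O.card ≤ k → ∀ e ∉ O, (∀ t ∈ A, e ∈ t → ¬ t ⊆ insert e O) →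
    M * indepSum lam O A ≤ lam * indepSum lam (insert e O) A

lemma indepSum_insert_filter_le {lam : ℝ} (hlam : 0 ≤ lam) {O : Finset α}
    (A : Finset (Finset α)) {e : α} (he : e ∉ O) :
    indepSum lam (insert e O) {t ∈ A | e ∉ t} ≤ indepSum lam O A := by
  rw [indepSum_split lam A he]
  have := mul_nonneg hlam (indepSum_nonneg hlam (insert e O) A)
  linarith

lemma occupationLE_self {lam : ℝ} (hlam : 0 ≤ lam) (T : Finset (Finset α)) (k : ℕ) :
    OccupationLE T lam k lam := by
  intro O A _ _ e he
  refine mul_le_mul_of_nonneg_left ?_ hlam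
  exact (indepSum_anti hlam _ (Finset.filter_subset _ _)).trans
    (indepSum_insert_filter_le hlam A he)

lemma OccupationLE.mono {lam : ℝ} (hlam : 0 ≤ lam) {T : Finset (Finset α)} {k : ℕ} {M M' : ℝ}
    (h : OccupationLE T lam k M) (hM : M ≤ M') : OccupationLE T lam k M' :=
  fun O A hA hO e he => (h O A hA hO e he).trans
    (mul_le_mul_of_nonneg_right hM (indepSum_nonneg hlam _ _))

lemma OccupationGE.mono {lam : ℝ} (hlam : 0 ≤ lam) {T : Finset (Finset α)} {k : ℕ} {M M' : ℝ}
    (h : OccupationGE T lam k M) (hM : M' ≤ M) : OccupationGE T lam k M' :=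
  fun O A hA hO e he hf => le_trans
    (mul_le_mul_of_nonneg_right hM (indepSum_nonneg hlam _ _)) (h O A hA hO e he hf)

/-- Upper bounds on occupation probabilities give lower bounds. -/
lemma OccupationLE.occupationGE {n k : ℕ} {T : Finset (Finset α)} (hT : NearRegularLinear n T)
    {lam M : ℝ} (hlam : 0 ≤ lam) (hM0 : 0 ≤ M) (hM1 : M ≤ 1)
    (hU : OccupationLE T lam (k + 2) M) :
    OccupationGE T lam k
      (lam * ((1 - M) ^ k * (1 - M ^ 2) ^ n) / (1 + lam * ((1 - M) ^ k * (1 - M ^ 2) ^ n))) := by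
  intro O A hA hO e he hforced
  have hM2 : 0 ≤ 1 - M ^ 2 := by nlinarith
  have hM2' : 1 - M ^ 2 ≤ 1 := by nlinarith [sq_nonneg M]
  set κ := (1 - M) ^ k * (1 - M ^ 2) ^ n with hκ
  have hκ0 : 0 ≤ κ := mul_nonneg (pow_nonneg (by linarith) _) (pow_nonneg hM2 _)
  let w : Finset α → ℝ := fun t => if Disjoint t O then 1 - M ^ 2 else 1 - M
  have hw : ∀ t, 0 ≤ w t := fun t => by
    simp only [w]; split_ifs <;> linarith
  have key : ∀ S ⊆ A.filter (e ∈ ·),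
      (∏ t ∈ S, w t) * indepSum lam (insert e O) {t ∈ A | e ∉ t} ≤
        indepSum lam (insert e O) ({t ∈ A | e ∉ t} ∪ S) := by
    intro S
    induction S using Finset.induction_on with
    | empty => intro _; simp
    | insert t S htS ih =>
      intro hS
      rw [Finset.insert_subset_iff, Finset.mem_filter] at hS
      obtain ⟨⟨htA, het⟩, hS⟩ := hS
      specialize ih hS
      rw [Finset.prod_insert htS, Finset.union_insert, mul_assoc]
      set B := {t ∈ A | e ∉ t} ∪ S with hB
      have hBA : B ⊆ A := Finset.union_subset (Finset.filter_subset _ _)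
        (hS.trans (Finset.filter_subset _ _))
      have hBc : IsCompleteOff T (insert e O) B := hA.insert_of_subset Finset.subset_union_left hBA
      have hcard : (insert e O).card ≤ k + 1 := by
        rw [Finset.card_insert_of_notMem he]; omega
      have h0 : 0 ≤ indepSum lam (insert e O) B := indepSum_nonneg hlam _ _
      suffices w t * indepSum lam (insert e O) B ≤ indepSum lam (insert e O) (insert t B) from
        (mul_le_mul_of_nonneg_left ih (hw t)).trans this
      obtain ⟨f, g, hfe, hge, hfg, rfl⟩ := exists_triple (hT.card_eq t (hA.1 htA)) het
      -- the case in which one further element of the triple is already occupied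
      have one : ∀ f g : α, f ≠ e → f ∉ O → g ∈ O → g ≠ f → ({e, f, g} : Finset α) ∈ A →
          (1 - M) * indepSum lam (insert e O) B ≤
            indepSum lam (insert e O) (insert {e, f, g} B) := by
        intro f g hfe hfO hgO hgf hA'
        have hf' : f ∉ insert e O := by simp [hfe, hfO]
        have h1 := indepSum_sub_insert lam B (t := {e, f, g}) hf' (by simp)
        rw [indepSum_eq_zero lam (O := insert f (insert e O)) (Finset.mem_insert_self _ B)
          (by intro a; simp only [Finset.mem_insert, Finset.mem_singleton]
              rintro (rfl | rfl | rfl) <;> simp [hgO])] at h1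
        have h2 := hU _ _ hBc (by omega) f hf'
        linarith
      have hnf := hforced _ htA het
      by_cases hfO : f ∈ O
      · by_cases hgO : g ∈ O
        · exact absurd (by intro a; simp only [Finset.mem_insert, Finset.mem_singleton]
                           rintro (rfl | rfl | rfl) <;> simp [hgO, hfO]) hnf
        · have : w {e, f, g} = 1 - M := if_neg (by
            rw [Finset.not_disjoint_iff]; exact ⟨f, by simp, hfO⟩)
          rw [this]
          have hc : ({e, f, g} : Finset α) = {e, g, f} := by rw [Finset.pair_comm f g]
          rw [hc] at htA ⊢
          exact one g f hge hgO hfO hfg htA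
      · by_cases hgO : g ∈ O
        · have : w {e, f, g} = 1 - M := if_neg (by
            rw [Finset.not_disjoint_iff]; exact ⟨g, by simp, hgO⟩)
          rw [this]
          exact one f g hfe hfO hgO hfg.symm htA
        · have : w {e, f, g} = 1 - M ^ 2 := if_pos (by
            simp [he, hfO, hgO])
          rw [this]
          have hf' : f ∉ insert e O := by simp [hfe, hfO]
          have hg' : g ∉ insert f (insert e O) := by simp [hge, hgO, hfg.symm]
          have h1 := indepSum_sub_insert lam B (t := {e, f, g}) hf' (by simp)
          have h2 := indepSum_sub_insert lam B (t := {e, f, g}) hg' (by simp)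
          rw [indepSum_eq_zero lam (O := insert g (insert f (insert e O)))
            (Finset.mem_insert_self _ B)
            (by intro a; simp only [Finset.mem_insert, Finset.mem_singleton]; tauto)] at h2
          have h3 := hU _ _ hBc (by omega) f hf'
          have h4 := hU _ _ (hBc.insert_right f)
            (by rw [Finset.card_insert_of_notMem hf']; omega) g hg'
          rw [h2, sub_zero] at h1
          have h5 := mul_le_mul_of_nonneg_left h4 hlam
          have h6 := mul_le_mul_of_nonneg_left h3 hM0
          nlinarith
  have h1 := key _ subset_rfl
  have hun : {t ∈ A | e ∉ t} ∪ A.filter (e ∈ ·) = A := by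
    rw [Finset.union_comm]; exact Finset.filter_union_filter_not_eq _ _
  rw [hun] at h1
  have hprod : κ ≤ ∏ t ∈ A.filter (e ∈ ·), w t := by
    rw [Finset.prod_ite, Finset.prod_const, Finset.prod_const, hκ, mul_comm]
    refine mul_le_mul ?_ ?_ (pow_nonneg (by linarith) _) (pow_nonneg hM2 _)
    · refine pow_le_pow_of_le_one hM2 hM2' ((Finset.card_le_card ?_).trans (hT.deg_le e))
      exact (Finset.filter_subset _ _).trans (Finset.filter_subset_filter _ hA.1)
    · refine pow_le_pow_of_le_one (by linarith) (by linarith)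
        ((Finset.card_le_card ?_).trans ((hT.card_meet_le he).trans hO))
      intro t ht
      simp only [Finset.mem_filter] at ht ⊢
      exact ⟨hA.1 ht.1.1, ht.1.2, ht.2⟩
  have h2 : κ * indepSum lam (insert e O) {t ∈ A | e ∉ t} ≤ indepSum lam (insert e O) A :=
    (mul_le_mul_of_nonneg_right hprod (indepSum_nonneg hlam _ _)).trans h1
  have hpos : 0 < 1 + lam * κ := by positivity
  rw [indepSum_split lam A he, div_mul_eq_mul_div, div_le_iff₀ hpos]
  have := mul_le_mul_of_nonneg_left h2 hlam
  nlinarith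

/-- Lower bounds on occupation probabilities give upper bounds. -/
lemma OccupationGE.occupationLE {n k : ℕ} {T : Finset (Finset α)} (hT : NearRegularLinear n T)
    {lam M : ℝ} (hlam : 0 ≤ lam) (hM0 : 0 ≤ M) (hM1 : M ≤ 1)
    (hL : OccupationGE T lam (k + 2) M) :
    OccupationLE T lam k (lam * (1 - M ^ 2) ^ (n - (2 + k + (k + 1) ^ 2))) := by
  intro O A hA hO e he
  have hM2 : 0 ≤ 1 - M ^ 2 := by nlinarith
  have hM2' : 1 - M ^ 2 ≤ 1 := by nlinarith [sq_nonneg M]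
  have hcard : (insert e O).card ≤ k + 1 := by
    rw [Finset.card_insert_of_notMem he]; omega
  let forced : Finset α → Prop := fun t => ∃ s ∈ A, ∃ f ∈ s, f ∈ t ∧ f ∉ insert e O ∧
    s ⊆ insert f (insert e O)
  let G : Finset (Finset α) := T.filter fun t => e ∈ t ∧ Disjoint t O ∧ ¬ forced t
  have hGA : G ⊆ A := fun t ht => by
    simp only [G, Finset.mem_filter] at ht
    exact hA.2 t ht.1 ht.2.2.1
  have hGcard : n - (2 + k + (k + 1) ^ 2) ≤ G.card := by
    have h1 := hT.le_deg e
    have h2 : T.filter (e ∈ ·) ⊆ G ∪ (T.filter fun t => e ∈ t ∧ ¬ Disjoint t O) ∪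
        (T.filter fun t => e ∈ t ∧ forced t) := by
      intro t ht
      simp only [G, Finset.mem_filter, Finset.mem_union] at ht ⊢
      tauto
    have h3 : (T.filter fun t => e ∈ t ∧ forced t).card ≤
        ((insert e O) ×ˢ (insert e O)).card := by
      refine Finset.card_le_card_of_forall_subsingleton
        (fun t p => p.1 ≠ p.2 ∧ ∃ s ∈ A, p.1 ∈ s ∧ p.2 ∈ s ∧ ∃ f ∈ s, f ∈ t ∧ f ∉ insert e O ∧
          s ⊆ insert f (insert e O)) ?_ ?_
      · intro t ht
        simp only [Finset.mem_filter] at ht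
        obtain ⟨-, -, s, hs, f, hfs, hft, hfO, hsub⟩ := ht
        obtain ⟨a, b, haf, hbf, hab, hsabc⟩ := exists_triple (hT.card_eq s (hA.1 hs)) hfs
        have ha : a ∈ s := by rw [hsabc]; simp
        have hb : b ∈ s := by rw [hsabc]; simp
        refine ⟨(a, b), Finset.mem_product.mpr ⟨?_, ?_⟩, hab, s, hs, ha, hb, f, hfs, hft, hfO, hsub⟩
        · exact (Finset.mem_insert.mp (hsub ha)).resolve_left haf
        · exact (Finset.mem_insert.mp (hsub hb)).resolve_left hbf
      · rintro ⟨a, b⟩ - t ⟨ht, hab, s, hs, has, hbs, f, hfs, hft, hfO, hsub⟩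
          t' ⟨ht', -, s', hs', has', hbs', f', hfs', hft', hfO', hsub'⟩
        simp only [Finset.mem_filter] at ht ht'
        obtain rfl := hT.linear s (hA.1 hs) s' (hA.1 hs') a b hab has hbs has' hbs'
        have hff : f' = f := (Finset.mem_insert.mp (hsub hfs')).resolve_right hfO'
        subst hff
        refine hT.linear t ht.1 t' ht'.1 e f' ?_ ht.2.1 hft ht'.2.1 hft'
        rintro rfl
        exact hfO (Finset.mem_insert_self _ _)
    rw [Finset.card_product] at h3
    have h4 := hT.card_meet_le he
    have h5 := (Finset.card_le_card h2).trans (Finset.card_union_le _ _)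
    have h6 := Finset.card_union_le G (T.filter fun t => e ∈ t ∧ ¬ Disjoint t O)
    have h7 : (insert e O).card * (insert e O).card ≤ (k + 1) ^ 2 := by
      rw [sq]; exact Nat.mul_le_mul hcard hcard
    omega
  have key : ∀ S ⊆ G, indepSum lam (insert e O) ({t ∈ A | e ∉ t} ∪ S) ≤
      (1 - M ^ 2) ^ S.card * indepSum lam (insert e O) {t ∈ A | e ∉ t} := by
    intro S
    induction S using Finset.induction_on with
    | empty => intro _; simp
    | insert t S htS ih =>
      intro hS
      rw [Finset.insert_subset_iff] at hS
      obtain ⟨htG, hS⟩ := hS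
      specialize ih hS
      have htA := hGA htG
      simp only [G, Finset.mem_filter] at htG
      obtain ⟨htT, het, htO, htf⟩ := htG
      rw [Finset.card_insert_of_notMem htS, Finset.union_insert, pow_succ', mul_assoc]
      set B := {t ∈ A | e ∉ t} ∪ S with hB
      have htB : t ∉ B := by
        simp [hB, htS, het]
      have hBA : B ⊆ A := Finset.union_subset (Finset.filter_subset _ _) (hS.trans hGA)
      have hBc : IsCompleteOff T (insert e O) B := hA.insert_of_subset Finset.subset_union_left hBA
      suffices indepSum lam (insert e O) (insert t B) ≤ (1 - M ^ 2) * indepSum lam (insert e O) B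
        from this.trans (mul_le_mul_of_nonneg_left ih hM2)
      obtain ⟨f, g, hfe, hge, hfg, rfl⟩ := exists_triple (hT.card_eq t htT) het
      have hfO : f ∉ O := Finset.disjoint_left.mp htO (by simp)
      have hgO : g ∉ O := Finset.disjoint_left.mp htO (by simp)
      have hf' : f ∉ insert e O := by simp [hfe, hfO]
      have hge' : g ∉ insert e O := by simp [hge, hgO]
      have hg' : g ∉ insert f (insert e O) := by simp [hge, hgO, hfg.symm]
      have h1 := indepSum_sub_insert lam B (t := {e, f, g}) hf' (by simp)
      have h2 := indepSum_sub_insert lam B (t := {e, f, g}) hg' (by simp)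
      rw [indepSum_eq_zero lam (O := insert g (insert f (insert e O)))
        (Finset.mem_insert_self _ B)
        (by intro a; simp only [Finset.mem_insert, Finset.mem_singleton]; tauto)] at h2
      have h3 := hL _ _ hBc (by omega) f hf' (fun s hs hfs hsub =>
        htf ⟨s, hBA hs, f, hfs, by simp, hf', hsub⟩)
      have h4 := hL _ _ (hBc.insert_right f)
        (by rw [Finset.card_insert_of_notMem hf']; omega) g hg' (fun s hs hgs hsub => by
          by_cases hfs : f ∈ s
          · have := hT.linear _ htT s (hA.1 (hBA hs)) f g hfg (by simp) (by simp) hfs hgs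
            exact htB (this ▸ hs)
          · refine htf ⟨s, hBA hs, g, hgs, by simp, hge', fun a ha => ?_⟩
            have := hsub ha
            simp only [Finset.mem_insert] at this ⊢
            rcases this with h | h | h
            · exact Or.inl h
            · exact absurd (h ▸ ha) hfs
            · exact Or.inr h)
      rw [h2, sub_zero] at h1
      have h5 := mul_le_mul_of_nonneg_left h4 hlam
      have h6 := mul_le_mul_of_nonneg_left h3 hM0
      nlinarith
  have hsub : {t ∈ A | e ∉ t} ∪ G ⊆ A := Finset.union_subset (Finset.filter_subset _ _) hGA
  rw [mul_assoc]
  refine mul_le_mul_of_nonneg_left ?_ hlam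
  calc indepSum lam (insert e O) A
      ≤ indepSum lam (insert e O) ({t ∈ A | e ∉ t} ∪ G) := indepSum_anti hlam _ hsub
    _ ≤ (1 - M ^ 2) ^ G.card * indepSum lam (insert e O) {t ∈ A | e ∉ t} := key G subset_rfl
    _ ≤ _ := mul_le_mul (pow_le_pow_of_le_one hM2 hM2' hGcard)
        (indepSum_insert_filter_le hlam A he) (indepSum_nonneg hlam _ _) (pow_nonneg hM2 _)

end LinearHypergraph

section Limits

open Real

lemma tendsto_one_sub_sq_div_pow (M : ℝ) :
    Tendsto (fun n : ℕ => (1 - (M / √n) ^ 2) ^ n) atTop (nhds (exp (-M ^ 2))) := by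
  have h := Real.tendsto_one_add_div_pow_exp (-M ^ 2)
  refine h.congr fun n => ?_
  rw [div_pow, Real.sq_sqrt n.cast_nonneg]
  ring

lemma tendsto_div_sqrt_natCast (M : ℝ) : Tendsto (fun n : ℕ => M / √n) atTop (nhds 0) :=
  tendsto_const_nhds.div_atTop (tendsto_sqrt_atTop.comp tendsto_natCast_atTop_atTop)

/-- Occupation probabilities at fugacity `c / √n` are eventually at most `M / √n`, uniformly over
all nearly regular linear hypergraphs. -/
def EventuallyOccupationLE (c : ℝ) (k : ℕ) (M : ℝ) : Prop :=
  ∀ᶠ n : ℕ in atTop, ∀ (α : Type) [Fintype α] [DecidableEq α] (T : Finset (Finset α)),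
    NearRegularLinear n T → OccupationLE T (c / √n) k (M / √n)

/-- Unforced occupation probabilities at fugacity `c / √n` are eventually at least `M / √n`,
uniformly over all nearly regular linear hypergraphs. -/
def EventuallyOccupationGE (c : ℝ) (k : ℕ) (M : ℝ) : Prop :=
  ∀ᶠ n : ℕ in atTop, ∀ (α : Type) [Fintype α] [DecidableEq α] (T : Finset (Finset α)),
    NearRegularLinear n T → OccupationGE T (c / √n) k (M / √n)

lemma eventuallyOccupationGE_of_LE {c M : ℝ} (hc : 0 < c) (hM : 0 ≤ M)
    (h : ∀ k, ∀ M' > M, EventuallyOccupationLE c k M') (k : ℕ) {m : ℝ}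
    (hm : m < c * exp (-M ^ 2)) : EventuallyOccupationGE c k m := by
  obtain ⟨M', hMM', hM'⟩ : ∃ M' > M, m < c * exp (-M' ^ 2) := by
    have hcont : ContinuousAt (fun y : ℝ => c * exp (-y ^ 2)) M := by fun_prop
    have := (hcont.eventually_const_lt hm)
    exact ((this.filter_mono nhdsWithin_le_nhds).and
      (self_mem_nhdsWithin : Set.Ioi M ∈ nhdsWithin M (Set.Ioi M))).exists.imp
      fun y hy => ⟨hy.2, hy.1⟩
  have hM'0 : 0 ≤ M' := hM.trans hMM'.le
  have hlim : Tendsto (fun n : ℕ => c * ((1 - M' / √n) ^ k * (1 - (M' / √n) ^ 2) ^ n) /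
      (1 + c / √n * ((1 - M' / √n) ^ k * (1 - (M' / √n) ^ 2) ^ n))) atTop
      (nhds (c * ((1 - 0) ^ k * exp (-M' ^ 2)) /
        (1 + 0 * ((1 - 0) ^ k * exp (-M' ^ 2))))) := by
    have h1 := (tendsto_const_nhds (x := (1 : ℝ))).sub (tendsto_div_sqrt_natCast M')
    have h2 := (h1.pow k).mul (tendsto_one_sub_sq_div_pow M')
    exact (h2.const_mul c).div (((tendsto_div_sqrt_natCast c).mul h2).const_add 1) (by simp)
  simp only [sub_zero, one_pow, one_mul, zero_mul, add_zero, div_one] at hlim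
  filter_upwards [h (k + 2) M' hMM', hlim.eventually_const_lt hM', eventually_gt_atTop 0,
    (tendsto_div_sqrt_natCast M').eventually_le_const one_pos] with n hn hlt hn0 hle
  intro α _ _ T hT
  have hs : 0 < √(n : ℝ) := Real.sqrt_pos.mpr (by exact_mod_cast hn0)
  refine ((hn α T hT).occupationGE hT (by positivity) (by positivity) hle).mono
    (by positivity) ?_
  rw [div_le_iff₀ hs]
  refine hlt.le.trans (le_of_eq ?_)
  field_simp

lemma eventuallyOccupationLE_of_GE {c m : ℝ} (hc : 0 < c) (hm : 0 < m)
    (h : ∀ k, ∀ m' < m, EventuallyOccupationGE c k m') (k : ℕ) {M : ℝ}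
    (hM : c * exp (-m ^ 2) < M) : EventuallyOccupationLE c k M := by
  obtain ⟨m', hm'0, hmm', hm'⟩ : ∃ m' > 0, m' < m ∧ c * exp (-m' ^ 2) < M := by
    have hcont : ContinuousAt (fun y : ℝ => c * exp (-y ^ 2)) m := by fun_prop
    have := (hcont.eventually_lt_const hM).and (eventually_gt_nhds hm)
    exact ((this.filter_mono nhdsWithin_le_nhds).and
      (self_mem_nhdsWithin : Set.Iio m ∈ nhdsWithin m (Set.Iio m))).exists.imp
      fun y hy => ⟨hy.1.2, hy.2, hy.1.1⟩
  set K := 2 + k + (k + 1) ^ 2 with hK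
  have hlim : Tendsto (fun n : ℕ => c * ((1 - (m' / √n) ^ 2) ^ n / (1 - (m' / √n) ^ 2) ^ K)) atTop
      (nhds (c * (exp (-m' ^ 2) / (1 - 0 ^ 2) ^ K))) := by
    have h1 := (tendsto_const_nhds (x := (1 : ℝ))).sub ((tendsto_div_sqrt_natCast m').pow 2)
    exact ((tendsto_one_sub_sq_div_pow m').div (h1.pow K) (by simp)).const_mul c
  simp only [ne_eq, OfNat.ofNat_ne_zero, not_false_eq_true, zero_pow, sub_zero, one_pow,
    div_one] at hlim
  filter_upwards [h (k + 2) m' hmm', hlim.eventually_lt_const hm', eventually_gt_atTop 0,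
    (tendsto_div_sqrt_natCast m').eventually_lt_const one_pos, eventually_ge_atTop K]
    with n hn hlt hn0 hle hnK
  intro α _ _ T hT
  have hs : 0 < √(n : ℝ) := Real.sqrt_pos.mpr (by exact_mod_cast hn0)
  refine ((hn α T hT).occupationLE hT (by positivity) (by positivity) hle.le).mono
    (by positivity) ?_
  rw [le_div_iff₀ hs]
  refine le_trans (le_of_eq ?_) hlt.le
  have hq : 0 ≤ m' / √(n : ℝ) := by positivity
  have hne : 1 - (m' / √(n : ℝ)) ^ 2 ≠ 0 := by nlinarith
  rw [← hK, pow_sub₀ _ hne hnK]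
  field_simp

/-- Two steps of the map `y ↦ c * exp (-y ^ 2)` in logarithmic coordinates. -/
def logTwoStep (c s : ℝ) : ℝ := log c - exp (2 * (log c - exp (2 * s)))

lemma mul_exp_neg_le (y : ℝ) : y * exp (-y) ≤ exp (-1) := by
  have h := add_one_le_exp (y - 1)
  have : exp (-1) = exp (y - 1) * exp (-y) := by rw [← exp_add]; ring_nf
  rw [this]
  exact mul_le_mul_of_nonneg_right (by linarith) (exp_pos _).le

lemma abs_logTwoStep_sub_le {c : ℝ} (hc : 0 < c) (a b : ℝ) :
    |logTwoStep c a - logTwoStep c b| ≤ 2 * c ^ 2 * exp (-1) * |a - b| := by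
  have hderiv : ∀ s : ℝ, HasDerivAt (logTwoStep c)
      (4 * exp (2 * s) * exp (2 * (log c - exp (2 * s)))) s := by
    intro s
    have h1 : HasDerivAt (fun s : ℝ => 2 * s) 2 s := by
      simpa using (hasDerivAt_id s).const_mul (2 : ℝ)
    have h2 := ((h1.exp.const_sub (log c)).const_mul 2).exp.const_sub (log c)
    refine h2.congr_deriv ?_
    ring
  have hbound : ∀ s : ℝ, ‖4 * exp (2 * s) * exp (2 * (log c - exp (2 * s)))‖ ≤
      2 * c ^ 2 * exp (-1) := by
    intro s
    rw [Real.norm_of_nonneg (by positivity)]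
    have h1 : exp (2 * (log c - exp (2 * s))) = c ^ 2 * exp (-(2 * exp (2 * s))) := by
      rw [mul_sub, sub_eq_add_neg, exp_add, mul_comm 2 (log c), exp_mul, exp_log hc]
      norm_cast
    rw [h1]
    have h2 := mul_exp_neg_le (2 * exp (2 * s))
    have h3 : 0 ≤ 2 * c ^ 2 := by positivity
    nlinarith [mul_le_mul_of_nonneg_left h2 h3]
  have := convex_univ.norm_image_sub_le_of_norm_hasDerivWithin_le
    (f := logTwoStep c) (fun s _ => (hderiv s).hasDerivWithinAt) (fun s _ => hbound s)
    (Set.mem_univ b) (Set.mem_univ a)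
  simpa [Real.norm_eq_abs] using this

lemma tendsto_logTwoStep_iterate {x : ℝ} (hx : 0 < x) (hx2 : x ^ 2 < 1 / 2) (a : ℝ) :
    Tendsto (fun t : ℕ => (logTwoStep (x * exp (x ^ 2)))^[t] a) atTop (nhds (log x)) := by
  set c := x * exp (x ^ 2) with hc
  have hc0 : 0 < c := by positivity
  have hlogc : log c = log x + x ^ 2 := by
    rw [hc, log_mul hx.ne' (exp_pos _).ne', log_exp]
  have hx' : exp (2 * log x) = x ^ 2 := by
    rw [mul_comm, exp_mul, exp_log hx]; norm_cast
  have hfix : logTwoStep c (log x) = log x := by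
    unfold logTwoStep
    rw [hx', hlogc, add_sub_cancel_right, hx', add_sub_cancel_right]
  set ρ := 2 * c ^ 2 * exp (-1) with hρ
  have hρ0 : 0 ≤ ρ := by positivity
  have hρ1 : ρ < 1 := by
    have : ρ = 2 * x ^ 2 * exp (2 * x ^ 2 - 1) := by
      rw [hρ, hc, sub_eq_add_neg, exp_add, mul_pow, ← exp_nat_mul]; push_cast; ring
    rw [this]
    have h1 : exp (2 * x ^ 2 - 1) < 1 := by rw [exp_lt_one_iff]; linarith
    have h2 : 0 < exp (2 * x ^ 2 - 1) := exp_pos _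
    nlinarith [sq_nonneg x]
  have hdist : ∀ t : ℕ, |(logTwoStep c)^[t] a - log x| ≤ ρ ^ t * |a - log x| := by
    intro t
    induction t with
    | zero => simp
    | succ t ih =>
      rw [Function.iterate_succ_apply', pow_succ', mul_assoc]
      calc _ = |logTwoStep c ((logTwoStep c)^[t] a) - logTwoStep c (log x)| := by rw [hfix]
        _ ≤ ρ * |(logTwoStep c)^[t] a - log x| := abs_logTwoStep_sub_le hc0 _ _
        _ ≤ _ := mul_le_mul_of_nonneg_left ih hρ0
  rw [tendsto_iff_dist_tendsto_zero]
  refine squeeze_zero (fun _ => dist_nonneg) (fun t => hdist t) ?_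
  simpa using (tendsto_pow_atTop_nhds_zero_of_lt_one hρ0 hρ1).mul_const |a - log x|

lemma exp_logTwoStep {c : ℝ} (hc : 0 < c) (s : ℝ) :
    exp (logTwoStep c s) = c * exp (-(c * exp (-(exp s) ^ 2)) ^ 2) := by
  have hsq : ∀ y : ℝ, exp (2 * y) = exp y ^ 2 := fun y => by
    rw [← exp_nat_mul]; norm_num
  rw [logTwoStep, sub_eq_add_neg, exp_add, exp_log hc, hsq, hsq, sub_eq_add_neg, exp_add,
    exp_log hc]

lemma eventuallyOccupationLE_iterate {c : ℝ} (hc : 0 < c) (t k : ℕ) {M : ℝ}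
    (hM : exp ((logTwoStep c)^[t] (log c)) < M) : EventuallyOccupationLE c k M := by
  induction t generalizing k M with
  | zero =>
    rw [Function.iterate_zero, id, exp_log hc] at hM
    refine Filter.Eventually.of_forall fun n α _ _ T _ => ?_
    exact (occupationLE_self (by positivity) T k).mono (by positivity) (by gcongr)
  | succ t ih =>
    rw [Function.iterate_succ_apply', exp_logTwoStep hc] at hM
    refine eventuallyOccupationLE_of_GE hc (by positivity) (fun k m' hm' => ?_) k hM
    exact eventuallyOccupationGE_of_LE hc (exp_pos _).le (fun k M' hM' => ih k hM') k hm'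

lemma eventuallyOccupationLE_of_lt {x M : ℝ} (hx : 0 < x) (hx2 : x ^ 2 < 1 / 2) (k : ℕ)
    (hM : x < M) : EventuallyOccupationLE (x * exp (x ^ 2)) k M := by
  have h := (tendsto_logTwoStep_iterate hx hx2 (log (x * exp (x ^ 2)))).rexp
  rw [exp_log hx] at h
  obtain ⟨t, ht⟩ := (h.eventually_lt_const hM).exists
  exact eventuallyOccupationLE_iterate (by positivity) t k ht

lemma eventuallyOccupationGE_of_lt {x m : ℝ} (hx : 0 < x) (hx2 : x ^ 2 < 1 / 2) (k : ℕ)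
    (hm : m < x) : EventuallyOccupationGE (x * exp (x ^ 2)) k m := by
  refine eventuallyOccupationGE_of_LE (M := x) (by positivity) hx.le
    (fun k M' hM' => eventuallyOccupationLE_of_lt hx hx2 k hM') k ?_
  rwa [mul_assoc, ← exp_add, add_neg_cancel, exp_zero, mul_one]

end Limits

section Triangles

/-- The edges of the complete graph on `Fin n`. -/
abbrev CompleteEdge (n : ℕ) : Type := {e : Sym2 (Fin n) // ¬ e.IsDiag}

lemma card_completeEdge (n : ℕ) : Fintype.card (CompleteEdge n) = n.choose 2 := by
  have := Sym2.card_subtype_not_diag (α := Fin n)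
  rw [Fintype.card_fin] at this
  rw [← this]

/-- The edges of the complete graph with both ends in `s`. -/
def edgesWithin {n : ℕ} (s : Finset (Fin n)) : Finset (CompleteEdge n) :=
  {e | ∀ v ∈ e.1, v ∈ s}

/-- The hypergraph on the edges of the complete graph whose members are the triangles. -/
def triangleHypergraph (n : ℕ) : Finset (Finset (CompleteEdge n)) :=
  (Finset.univ.powersetCard 3).image edgesWithin

lemma mem_edgesWithin {n : ℕ} {s : Finset (Fin n)} {e : CompleteEdge n} :
    e ∈ edgesWithin s ↔ ∀ v ∈ e.1, v ∈ s := by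
  simp [edgesWithin]

lemma mem_triangleHypergraph {n : ℕ} {t : Finset (CompleteEdge n)} :
    t ∈ triangleHypergraph n ↔ ∃ s : Finset (Fin n), s.card = 3 ∧ edgesWithin s = t := by
  simp [triangleHypergraph, Finset.mem_powersetCard]

lemma card_edgesWithin {n : ℕ} {s : Finset (Fin n)} (hs : s.card = 3) :
    (edgesWithin s).card = 3 := by
  obtain ⟨a, b, c, hab, hac, hbc, rfl⟩ := Finset.card_eq_three.mp hs
  have : edgesWithin ({a, b, c} : Finset (Fin n)) =
      {⟨s(a, b), by simpa using hab⟩, ⟨s(a, c), by simpa using hac⟩,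
        ⟨s(b, c), by simpa using hbc⟩} := by
    ext ⟨e, he⟩
    induction e using Sym2.ind with
    | _ u v =>
      simp only [mem_edgesWithin, Sym2.mem_iff, Finset.mem_insert, Finset.mem_singleton,
        Subtype.mk.injEq, Sym2.eq_iff, forall_eq_or_imp, forall_eq]
      rw [Sym2.mk_isDiag_iff] at he
      grind
  rw [this, Finset.card_eq_three]
  refine ⟨_, _, _, ?_, ?_, ?_, rfl⟩ <;>
    simp only [ne_eq, Subtype.mk.injEq, Sym2.eq_iff] <;> grind

lemma eq_of_mem_edgesWithin {n : ℕ} {s s' : Finset (Fin n)} (hs : s.card = 3) (hs' : s'.card = 3)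
    {e f : CompleteEdge n} (hef : e ≠ f) (hes : e ∈ edgesWithin s) (hfs : f ∈ edgesWithin s)
    (hes' : e ∈ edgesWithin s') (hfs' : f ∈ edgesWithin s') : s = s' := by
  suffices h : 3 ≤ (s ∩ s').card by
    have h1 : s ∩ s' = s := Finset.eq_of_subset_of_card_le Finset.inter_subset_left (by omega)
    have h2 : s ∩ s' = s' := Finset.eq_of_subset_of_card_le Finset.inter_subset_right (by omega)
    exact h1.symm.trans h2
  rw [mem_edgesWithin] at hes hfs hes' hfs'
  obtain ⟨e, he⟩ := e
  obtain ⟨f, hf⟩ := f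
  induction e using Sym2.ind with
  | _ a b =>
    induction f using Sym2.ind with
    | _ c d =>
      simp only [Sym2.mem_iff, forall_eq_or_imp, forall_eq] at hes hfs hes' hfs'
      rw [Sym2.mk_isDiag_iff] at he hf
      simp only [ne_eq, Subtype.mk.injEq, Sym2.eq_iff] at hef
      by_cases hc : c = a ∨ c = b
      · have hd : d ≠ a ∧ d ≠ b := by grind
        have : ({a, b, d} : Finset (Fin n)) ⊆ s ∩ s' := by
          intro x; simp only [Finset.mem_insert, Finset.mem_singleton, Finset.mem_inter]; grind
        refine le_trans (le_of_eq ?_) (Finset.card_le_card this)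
        rw [eq_comm, Finset.card_eq_three]
        exact ⟨a, b, d, he, hd.1.symm, hd.2.symm, rfl⟩
      · have : ({a, b, c} : Finset (Fin n)) ⊆ s ∩ s' := by
          intro x; simp only [Finset.mem_insert, Finset.mem_singleton, Finset.mem_inter]; grind
        refine le_trans (le_of_eq ?_) (Finset.card_le_card this)
        rw [eq_comm, Finset.card_eq_three]
        exact ⟨a, b, c, he, by grind, by grind, rfl⟩

lemma edgesWithin_insert_injOn {n : ℕ} (a b : Fin n) :
    Set.InjOn (fun c : Fin n => edgesWithin ({a, b, c} : Finset (Fin n)))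
      (({a, b} : Finset (Fin n))ᶜ : Finset (Fin n)) := by
  intro c hc d hd h
  simp only [Finset.coe_compl, Finset.coe_insert, Finset.coe_singleton, Set.mem_compl_iff,
    Set.mem_insert_iff, Set.mem_singleton_iff, not_or] at hc hd
  have hac : (⟨s(a, c), by simpa using fun h => hc.1 h.symm⟩ : CompleteEdge n) ∈
      edgesWithin ({a, b, c} : Finset (Fin n)) := by
    simp [mem_edgesWithin]
  simp only at h
  rw [h, mem_edgesWithin] at hac
  have := hac c (by simp)
  simp only [Finset.mem_insert, Finset.mem_singleton] at this
  tauto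

lemma filter_mem_triangleHypergraph {n : ℕ} {a b : Fin n} (hab : ¬ s(a, b).IsDiag) :
    (triangleHypergraph n).filter ((⟨s(a, b), hab⟩ : CompleteEdge n) ∈ ·) =
      (({a, b} : Finset (Fin n))ᶜ).image (fun c => edgesWithin {a, b, c}) := by
  have hne : a ≠ b := by rwa [Sym2.mk_isDiag_iff] at hab
  ext t
  simp only [Finset.mem_filter, mem_triangleHypergraph, Finset.mem_image, Finset.mem_compl]
  constructor
  · rintro ⟨⟨s, hs, rfl⟩, he⟩
    rw [mem_edgesWithin] at he
    have ha : a ∈ s := he a (by simp)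
    have hb : b ∈ s := he b (by simp)
    obtain ⟨f, g, hfa, hga, hfg, hsfg⟩ := exists_triple hs ha
    have hb' : b = f ∨ b = g := by
      rw [hsfg] at hb
      simp only [Finset.mem_insert, Finset.mem_singleton] at hb
      exact hb.resolve_left hne.symm
    rcases hb' with rfl | rfl
    · exact ⟨g, by simp [hga, hfg.symm], by rw [hsfg]⟩
    · exact ⟨f, by simp [hfa, hfg], by rw [hsfg, Finset.pair_comm]⟩
  · rintro ⟨c, hc, rfl⟩
    simp only [Finset.mem_insert, Finset.mem_singleton, not_or] at hc
    refine ⟨⟨_, Finset.card_eq_three.mpr ⟨a, b, c, hne, fun h => hc.1 h.symm,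
      fun h => hc.2 h.symm, rfl⟩, rfl⟩, ?_⟩
    simp [mem_edgesWithin]

lemma nearRegularLinear_triangleHypergraph (n : ℕ) :
    NearRegularLinear n (triangleHypergraph n) := by
  have hdeg : ∀ e : CompleteEdge n, ((triangleHypergraph n).filter (e ∈ ·)).card = n - 2 := by
    rintro ⟨e, he⟩
    induction e using Sym2.ind with
    | _ a b =>
      have hab : a ≠ b := by rwa [Sym2.mk_isDiag_iff] at he
      rw [filter_mem_triangleHypergraph he, Finset.card_image_of_injOn
        (edgesWithin_insert_injOn a b), Finset.card_compl, Fintype.card_fin,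
        Finset.card_pair hab]
  refine ⟨fun t ht => ?_, fun t ht t' ht' e f hef he hf he' hf' => ?_, fun e => ?_, fun e => ?_⟩
  · obtain ⟨s, hs, rfl⟩ := mem_triangleHypergraph.mp ht
    exact card_edgesWithin hs
  · obtain ⟨s, hs, rfl⟩ := mem_triangleHypergraph.mp ht
    obtain ⟨s', hs', rfl⟩ := mem_triangleHypergraph.mp ht'
    rw [eq_of_mem_edgesWithin hs hs' hef he hf he' hf']
  · rw [hdeg]; omega
  · rw [hdeg]; omega

/-- Graphs on `Fin n` correspond to sets of edges of the complete graph. -/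
def graphEquivEdges (n : ℕ) : SimpleGraph (Fin n) ≃ Finset (CompleteEdge n) where
  toFun G := {e | e.1 ∈ G.edgeSet}
  invFun I := SimpleGraph.fromEdgeSet {e | ∃ h : ¬ e.IsDiag, (⟨e, h⟩ : CompleteEdge n) ∈ I}
  left_inv G := by
    ext a b
    simp only [SimpleGraph.fromEdgeSet_adj, Set.mem_ofPred_eq, Finset.mem_filter, Finset.mem_univ,
      true_and, SimpleGraph.mem_edgeSet, Sym2.mk_isDiag_iff]
    exact ⟨fun h => h.1.2, fun h => ⟨⟨h.ne, h⟩, h.ne⟩⟩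
  right_inv I := by
    ext ⟨e, he⟩
    simp only [SimpleGraph.edgeSet_fromEdgeSet, Finset.mem_filter, Finset.mem_univ, true_and]
    constructor
    · rintro ⟨⟨h, h'⟩, -⟩
      exact h'
    · intro h
      exact ⟨⟨he, h⟩, he⟩

lemma mem_graphEquivEdges {n : ℕ} {G : SimpleGraph (Fin n)} {e : CompleteEdge n} :
    e ∈ graphEquivEdges n G ↔ e.1 ∈ G.edgeSet := by
  simp [graphEquivEdges]

lemma card_graphEquivEdges {n : ℕ} (G : SimpleGraph (Fin n)) :
    (graphEquivEdges n G).card = edgeCount G := by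
  rw [edgeCount, ← Nat.card_eq_finsetCard]
  refine Nat.card_congr ⟨fun e => ⟨e.1.1, mem_graphEquivEdges.mp e.2⟩,
    fun e => ⟨⟨e.1, G.not_isDiag_of_mem_edgeSet e.2⟩, mem_graphEquivEdges.mpr e.2⟩,
    fun _ => rfl, fun _ => rfl⟩

lemma triCount_eq_zero_iff {n : ℕ} (G : SimpleGraph (Fin n)) :
    triCount G = 0 ↔ ∀ t ∈ triangleHypergraph n, ¬ t ⊆ graphEquivEdges n G := by
  have hcl : ∀ s : Finset (Fin n), G.IsClique s ↔ edgesWithin s ⊆ graphEquivEdges n G := by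
    intro s
    constructor
    · rintro h ⟨e, he⟩ hes
      rw [mem_edgesWithin] at hes
      rw [mem_graphEquivEdges]
      induction e using Sym2.ind with
      | _ a b =>
        rw [Sym2.mk_isDiag_iff] at he
        exact h (hes a (by simp)) (hes b (by simp)) he
    · intro h a ha b hb hab
      have := @h ⟨s(a, b), by simpa using hab⟩ (by
        rw [mem_edgesWithin]
        simp only [Sym2.mem_iff, forall_eq_or_imp, forall_eq]
        exact ⟨ha, hb⟩)
      exact mem_graphEquivEdges.mp this
  unfold triCount
  rw [Finite.card_eq_zero_iff, isEmpty_subtype]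
  constructor
  · intro h t ht hsub
    obtain ⟨s, hs, rfl⟩ := mem_triangleHypergraph.mp ht
    exact h s ⟨(hcl s).mpr hsub, hs⟩
  · intro h s hs
    exact h _ (mem_triangleHypergraph.mpr ⟨s, hs.card_eq, rfl⟩) ((hcl s).mp hs.isClique)

/-- The triangle-free edge sets of size `k`. -/
def triFreeSets (n k : ℕ) : Finset (Finset (CompleteEdge n)) :=
  {I | I.card = k ∧ ∀ t ∈ triangleHypergraph n, ¬ t ⊆ I}

lemma triFreeCount_eq_card (n k : ℕ) : triFreeCount n k = (triFreeSets n k).card := by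
  rw [triFreeCount, ← Nat.card_eq_finsetCard]
  refine Nat.card_congr ((graphEquivEdges n).subtypeEquiv fun G => ?_)
  simp [triFreeSets, card_graphEquivEdges, triCount_eq_zero_iff]

/-- The probability that `G(n,k)` is triangle-free decreases with `k`. -/
lemma triFreeCount_div_choose_succ_le (n k : ℕ) :
    (triFreeCount n (k + 1) : ℝ) / (n.choose 2).choose (k + 1) ≤
      (triFreeCount n k : ℝ) / (n.choose 2).choose k := by
  have hsized : (triFreeSets n (k + 1) : Set (Finset (CompleteEdge n))).Sized (k + 1) := by
    intro I hI
    simp only [triFreeSets, Finset.coe_filter, Finset.mem_univ, true_and] at hI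
    exact hI.1
  have h := Finset.local_lubell_yamamoto_meshalkin_inequality_div (𝕜 := ℝ) (Nat.succ_ne_zero k)
    hsized
  rw [card_completeEdge, Nat.succ_eq_add_one, Nat.add_sub_cancel] at h
  rw [triFreeCount_eq_card, triFreeCount_eq_card]
  refine h.trans ?_
  gcongr
  intro J hJ
  rw [Finset.mem_shadow_iff] at hJ
  obtain ⟨I, hI, a, ha, rfl⟩ := hJ
  simp only [triFreeSets, Finset.mem_filter, Finset.mem_univ, true_and] at hI ⊢
  refine ⟨by rw [Finset.card_erase_of_mem ha, hI.1, Nat.add_sub_cancel], fun t ht hsub => ?_⟩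
  exact hI.2 t ht (hsub.trans (Finset.erase_subset _ _))

lemma triFreeCount_div_choose_anti (n : ℕ) {j k : ℕ} (hjk : j ≤ k) :
    (triFreeCount n k : ℝ) / (n.choose 2).choose k ≤
      (triFreeCount n j : ℝ) / (n.choose 2).choose j := by
  induction k, hjk using Nat.le_induction with
  | base => exact le_rfl
  | succ k _ ih => exact (triFreeCount_div_choose_succ_le n k).trans ih

/-- The generating function of triangle-free graphs by number of edges. -/
def triFreeSum (n : ℕ) (lam : ℝ) : ℝ :=
  ∑ k ∈ Finset.range (n.choose 2 + 1), triFreeCount n k * lam ^ k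

/-- The derivative of `triFreeSum n`. -/
def triFreeSumDeriv (n : ℕ) (lam : ℝ) : ℝ :=
  ∑ k ∈ Finset.range (n.choose 2 + 1), triFreeCount n k * (k * lam ^ (k - 1))

lemma sum_triFreeCount_mul (n : ℕ) (F : ℕ → ℝ) :
    ∑ k ∈ Finset.range (n.choose 2 + 1), triFreeCount n k * F k =
      ∑ I : Finset (CompleteEdge n) with
        Disjoint I ∅ ∧ ∀ t ∈ triangleHypergraph n, ¬ t ⊆ I ∪ ∅, F I.card := by
  have hmaps : ∀ I ∈ (Finset.univ.filter fun I : Finset (CompleteEdge n) =>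
      Disjoint I ∅ ∧ ∀ t ∈ triangleHypergraph n, ¬ t ⊆ I ∪ ∅),
      I.card ∈ Finset.range (n.choose 2 + 1) := by
    intro I _
    have := I.card_le_univ
    rw [card_completeEdge] at this
    simp only [Finset.mem_range]; omega
  rw [← Finset.sum_fiberwise_of_maps_to hmaps]
  refine Finset.sum_congr rfl fun k _ => ?_
  rw [Finset.sum_congr rfl (g := fun _ => F k) (by
    intro I hI; rw [(Finset.mem_filter.mp hI).2]), Finset.sum_const, nsmul_eq_mul,
    triFreeCount_eq_card, triFreeSets]
  congr 3
  ext I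
  simp [and_comm]

lemma triFreeSum_eq_indepSum (n : ℕ) (lam : ℝ) :
    triFreeSum n lam = indepSum lam ∅ (triangleHypergraph n) :=
  sum_triFreeCount_mul n _

lemma mul_triFreeSumDeriv (n : ℕ) (lam : ℝ) :
    lam * triFreeSumDeriv n lam =
      ∑ e : CompleteEdge n, lam * indepSum lam (insert e ∅) (triangleHypergraph n) := by
  have h1 : lam * triFreeSumDeriv n lam =
      ∑ k ∈ Finset.range (n.choose 2 + 1), triFreeCount n k * (k * lam ^ k) := by
    rw [triFreeSumDeriv, Finset.mul_sum]
    refine Finset.sum_congr rfl fun k _ => ?_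
    rcases k with _ | k
    · simp
    · rw [Nat.add_sub_cancel, pow_succ]; ring
  rw [h1, sum_triFreeCount_mul n (fun k => k * lam ^ k)]
  have h2 : ∀ e : CompleteEdge n, lam * indepSum lam (insert e ∅) (triangleHypergraph n) =
      ∑ I : Finset (CompleteEdge n) with
        Disjoint I ∅ ∧ ∀ t ∈ triangleHypergraph n, ¬ t ⊆ I ∪ ∅,
        if e ∈ I then lam ^ I.card else 0 := by
    intro e
    rw [← sum_filter_mem_eq_mul_indepSum lam (triangleHypergraph n) (Finset.notMem_empty e),
      Finset.sum_filter]
  rw [Finset.sum_congr rfl fun e _ => h2 e, Finset.sum_comm]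
  refine Finset.sum_congr rfl fun I _ => ?_
  simp

lemma hasDerivAt_triFreeSum (n : ℕ) (lam : ℝ) :
    HasDerivAt (triFreeSum n) (triFreeSumDeriv n lam) lam := by
  unfold triFreeSum triFreeSumDeriv
  exact HasDerivAt.fun_sum fun k _ => (hasDerivAt_pow k lam).const_mul _

lemma triFreeCount_zero (n : ℕ) : triFreeCount n 0 = 1 := by
  rw [triFreeCount_eq_card, Finset.card_eq_one]
  refine ⟨∅, ?_⟩
  ext I
  simp only [triFreeSets, Finset.mem_filter, Finset.mem_univ, true_and, Finset.mem_singleton,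
    Finset.card_eq_zero, and_iff_left_iff_imp]
  rintro rfl t ht hsub
  have := (nearRegularLinear_triangleHypergraph n).card_eq t ht
  rw [Finset.subset_empty.mp hsub] at this
  simp at this

lemma one_le_triFreeSum (n : ℕ) {lam : ℝ} (hlam : 0 ≤ lam) : 1 ≤ triFreeSum n lam := by
  unfold triFreeSum
  rw [Finset.sum_range_succ', triFreeCount_zero]
  simp only [Nat.cast_one, pow_zero, mul_one, le_add_iff_nonneg_left]
  positivity

lemma triFreeSum_zero (n : ℕ) : triFreeSum n 0 = 1 := by
  unfold triFreeSum
  rw [Finset.sum_range_succ', triFreeCount_zero]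
  simp

lemma isCompleteOff_self (n : ℕ) : IsCompleteOff (triangleHypergraph n) ∅ (triangleHypergraph n) :=
  ⟨subset_rfl, fun _ h _ => h⟩

lemma mul_triFreeSumDeriv_le {n : ℕ} {lam M : ℝ}
    (h : OccupationLE (triangleHypergraph n) lam 0 M) :
    lam * triFreeSumDeriv n lam ≤ n.choose 2 * M * triFreeSum n lam := by
  rw [mul_triFreeSumDeriv, triFreeSum_eq_indepSum, ← card_completeEdge, mul_assoc, ← nsmul_eq_mul,
    ← Finset.card_univ]
  exact Finset.sum_le_card_nsmul _ _ _ fun e _ =>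
    h ∅ _ (isCompleteOff_self n) (by simp) e (Finset.notMem_empty e)

lemma le_mul_triFreeSumDeriv {n : ℕ} {lam M : ℝ}
    (h : OccupationGE (triangleHypergraph n) lam 0 M) :
    n.choose 2 * M * triFreeSum n lam ≤ lam * triFreeSumDeriv n lam := by
  rw [mul_triFreeSumDeriv, triFreeSum_eq_indepSum, ← card_completeEdge, mul_assoc, ← nsmul_eq_mul,
    ← Finset.card_univ]
  refine Finset.card_nsmul_le_sum _ _ _ fun e _ =>
    h ∅ _ (isCompleteOff_self n) (by simp) e (Finset.notMem_empty e) fun t ht _ hsub => ?_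
  have h1 := (nearRegularLinear_triangleHypergraph n).card_eq t ht
  have h2 := Finset.card_le_card hsub
  simp only [insert_empty_eq, Finset.card_singleton] at h2
  omega

end Triangles

section Asymptotics

lemma tendsto_natCast_rpow_atTop :
    Tendsto (fun n : ℕ => (n : ℝ) ^ ((3 : ℝ) / 2)) atTop atTop :=
  (tendsto_rpow_atTop (by norm_num)).comp tendsto_natCast_atTop_atTop

lemma sqrt_mul_rpow {x : ℝ} (hx : 0 < x) : √x * x ^ ((3 : ℝ) / 2) = x ^ 2 := by
  rw [Real.sqrt_eq_rpow, ← Real.rpow_add hx, ← Real.rpow_natCast]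
  norm_num

lemma tendsto_choose_two_div :
    Tendsto (fun n : ℕ => (n.choose 2 : ℝ) / (n : ℝ) ^ 2) atTop (nhds (1 / 2)) := by
  have h : Tendsto (fun n : ℕ => (1 - (n : ℝ)⁻¹) / 2) atTop (nhds ((1 - 0) / 2)) :=
    (tendsto_const_nhds.sub tendsto_inv_atTop_nhds_zero_nat).div_const 2
  rw [sub_zero] at h
  refine h.congr' ?_
  filter_upwards [eventually_gt_atTop 0] with n hn
  have : (0 : ℝ) < n := by exact_mod_cast hn
  rw [Nat.cast_choose_two]
  field_simp

lemma choose_two_le (n : ℕ) : (n.choose 2 : ℝ) ≤ (n : ℝ) ^ 2 / 2 := by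
  rw [Nat.cast_choose_two]
  nlinarith [(Nat.cast_nonneg n : (0 : ℝ) ≤ n)]

lemma triFreeSumDeriv_nonneg (n : ℕ) {lam : ℝ} (hlam : 0 ≤ lam) : 0 ≤ triFreeSumDeriv n lam := by
  unfold triFreeSumDeriv
  positivity

lemma triFreeSumDeriv_le (n : ℕ) {lam : ℝ} (hlam : 0 < lam) :
    triFreeSumDeriv n lam ≤ n.choose 2 * triFreeSum n lam := by
  have h := mul_triFreeSumDeriv_le (occupationLE_self (T := triangleHypergraph n) hlam.le 0)
  refine le_of_mul_le_mul_left (h.trans_eq ?_) hlam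
  ring

lemma tendsto_logDeriv_triFreeSum {x : ℝ} (hx : 0 < x) (hx2 : x ^ 2 < 1 / 2) :
    Tendsto (fun n : ℕ => x * Real.exp (x ^ 2) / √n *
        triFreeSumDeriv n (x * Real.exp (x ^ 2) / √n) /
          triFreeSum n (x * Real.exp (x ^ 2) / √n) / (n : ℝ) ^ ((3 : ℝ) / 2))
      atTop (nhds (x / 2)) := by
  set c := x * Real.exp (x ^ 2)
  have hc : 0 < c := by positivity
  have hquot : Tendsto (fun n : ℕ => c / √n * triFreeSumDeriv n (c / √n) /
      triFreeSum n (c / √n) / (n.choose 2 / √n)) atTop (nhds x) := by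
    have hpos : ∀ n : ℕ, 2 ≤ n → 0 < (n.choose 2 : ℝ) / √n := by
      intro n hn
      have : 0 < n.choose 2 := Nat.choose_pos hn
      have : 0 < n := by omega
      positivity
    have hZ : ∀ n : ℕ, 0 < triFreeSum n (c / √n) := fun n =>
      zero_lt_one.trans_le (one_le_triFreeSum n (by positivity))
    rw [tendsto_order]
    constructor
    · intro a ha
      obtain ⟨M, haM, hMx⟩ := exists_between ha
      filter_upwards [eventuallyOccupationGE_of_lt hx hx2 0 hMx, eventually_ge_atTop 2] with n h hn
      refine haM.trans_le ?_
      rw [le_div_iff₀ (hpos n hn), le_div_iff₀ (hZ n)]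
      refine le_trans (le_of_eq ?_) (le_mul_triFreeSumDeriv (h _ _
        (nearRegularLinear_triangleHypergraph n)))
      ring
    · intro a ha
      obtain ⟨M, hxM, hMa⟩ := exists_between ha
      filter_upwards [eventuallyOccupationLE_of_lt hx hx2 0 hxM, eventually_ge_atTop 2] with n h hn
      refine lt_of_le_of_lt ?_ hMa
      rw [div_le_iff₀ (hpos n hn), div_le_iff₀ (hZ n)]
      refine (mul_triFreeSumDeriv_le (h _ _
        (nearRegularLinear_triangleHypergraph n))).trans (le_of_eq ?_)
      ring
  have h := hquot.mul tendsto_choose_two_div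
  rw [mul_one_div] at h
  refine h.congr' ?_
  filter_upwards [eventually_ge_atTop 2] with n hn
  have hn0 : (0 : ℝ) < n := by exact_mod_cast (by omega : 0 < n)
  have hN : (n.choose 2 : ℝ) ≠ 0 := by exact_mod_cast (Nat.choose_pos hn).ne'
  have h1 : √(n : ℝ) ≠ 0 := (Real.sqrt_pos.mpr hn0).ne'
  have h2 : (n : ℝ) ^ ((3 : ℝ) / 2) ≠ 0 := (Real.rpow_pos_of_pos hn0 _).ne'
  rw [← sqrt_mul_rpow hn0]
  generalize triFreeSumDeriv n (c / √n) / triFreeSum n (c / √n) = q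
  field_simp

lemma hasDerivAt_mul_exp_sq (x : ℝ) :
    HasDerivAt (fun y : ℝ => y * Real.exp (y ^ 2)) (Real.exp (x ^ 2) * (1 + 2 * x ^ 2)) x := by
  refine ((hasDerivAt_id x).mul ((hasDerivAt_pow 2 x).exp)).congr_deriv ?_
  simp only [id_eq]
  push_cast
  ring

/-- The free energy of the triangle-free hard-core model at fugacity `x * exp (x ^ 2) / √n`. -/
lemma tendsto_log_triFreeSum {x : ℝ} (hx : 0 < x) (hx2 : x ^ 2 < 1 / 2) :
    Tendsto (fun n : ℕ => Real.log (triFreeSum n (x * Real.exp (x ^ 2) / √n)) /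
      (n : ℝ) ^ ((3 : ℝ) / 2)) atTop (nhds (x / 2 + x ^ 3 / 3)) := by
  set g : ℕ → ℝ → ℝ := fun n y =>
    triFreeSumDeriv n (y * Real.exp (y ^ 2) / √n) / triFreeSum n (y * Real.exp (y ^ 2) / √n) *
      (Real.exp (y ^ 2) * (1 + 2 * y ^ 2) / √n) / (n : ℝ) ^ ((3 : ℝ) / 2) with hg
  have hZ : ∀ (n : ℕ) (y : ℝ), 0 ≤ y → 0 < triFreeSum n (y * Real.exp (y ^ 2) / √n) :=
    fun n y hy => zero_lt_one.trans_le (one_le_triFreeSum n (by positivity))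
  have hcontZ : ∀ n, Continuous (triFreeSum n) := fun n => by unfold triFreeSum; fun_prop
  have hcontZ' : ∀ n, Continuous (triFreeSumDeriv n) := fun n => by
    unfold triFreeSumDeriv; fun_prop
  have hcont : ∀ n, ContinuousOn (g n) (Set.uIcc 0 x) := by
    intro n
    have h1 : Continuous fun y : ℝ => y * Real.exp (y ^ 2) / √n := by fun_prop
    have h2 : Continuous fun y : ℝ => Real.exp (y ^ 2) * (1 + 2 * y ^ 2) / √n := by fun_prop
    refine ((((hcontZ' n).comp h1).continuousOn.div ((hcontZ n).comp h1).continuousOn ?_).mul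
      h2.continuousOn).div_const _
    intro y hy
    rw [Set.uIcc_of_le hx.le] at hy
    exact (hZ n y hy.1).ne'
  have hint : ∀ n : ℕ, ∫ y in (0 : ℝ)..x, g n y =
      Real.log (triFreeSum n (x * Real.exp (x ^ 2) / √n)) / (n : ℝ) ^ ((3 : ℝ) / 2) := by
    intro n
    have hd : ∀ y ∈ Set.uIcc 0 x, HasDerivAt (fun y : ℝ =>
        Real.log (triFreeSum n (y * Real.exp (y ^ 2) / √n)) / (n : ℝ) ^ ((3 : ℝ) / 2))
        (g n y) y := by
      intro y hy
      rw [Set.uIcc_of_le hx.le] at hy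
      have h1 := (hasDerivAt_mul_exp_sq y).div_const √n
      have h2 := (hasDerivAt_triFreeSum n (y * Real.exp (y ^ 2) / √n)).comp y h1
      refine ((h2.log (hZ n y hy.1).ne').div_const ((n : ℝ) ^ ((3 : ℝ) / 2))).congr_deriv ?_
      simp only [hg, Function.comp_apply]
      ring
    rw [intervalIntegral.integral_eq_sub_of_hasDerivAt hd (hcont n).intervalIntegrable]
    simp [triFreeSum_zero]
  have hlim : ∫ y in (0 : ℝ)..x, (1 / 2 + y ^ 2) = x / 2 + x ^ 3 / 3 := by
    rw [intervalIntegral.integral_add (by simp) (by simp)]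
    simp only [intervalIntegral.integral_const, integral_pow, smul_eq_mul]
    norm_num
    ring
  rw [← hlim]
  refine Tendsto.congr hint ?_
  refine intervalIntegral.tendsto_integral_filter_of_dominated_convergence
    (fun y => Real.exp (y ^ 2) * (1 + 2 * y ^ 2) / 2) ?_ ?_ ?_ ?_
  · refine Eventually.of_forall fun n => ?_
    exact ((hcont n).mono Set.uIoc_subset_uIcc).aestronglyMeasurable measurableSet_uIoc
  · filter_upwards [eventually_gt_atTop 0] with n hn
    refine Eventually.of_forall fun y hy => ?_
    rw [Set.uIoc_of_le hx.le] at hy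
    have hn0 : (0 : ℝ) < n := by exact_mod_cast hn
    have hsq : 0 < √(n : ℝ) := Real.sqrt_pos.mpr hn0
    have hrp : 0 < (n : ℝ) ^ ((3 : ℝ) / 2) := Real.rpow_pos_of_pos hn0 _
    have hlam : 0 < y * Real.exp (y ^ 2) / √n := div_pos (mul_pos hy.1 (Real.exp_pos _)) hsq
    have hZy := hZ n y hy.1.le
    have hq : triFreeSumDeriv n (y * Real.exp (y ^ 2) / √n) /
        triFreeSum n (y * Real.exp (y ^ 2) / √n) ≤ √n * (n : ℝ) ^ ((3 : ℝ) / 2) / 2 := by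
      rw [sqrt_mul_rpow hn0, div_le_iff₀ hZy]
      exact (triFreeSumDeriv_le n hlam).trans
        (mul_le_mul_of_nonneg_right (choose_two_le n) hZy.le)
    have hq0 : 0 ≤ triFreeSumDeriv n (y * Real.exp (y ^ 2) / √n) /
        triFreeSum n (y * Real.exp (y ^ 2) / √n) :=
      div_nonneg (triFreeSumDeriv_nonneg n hlam.le) hZy.le
    rw [Real.norm_of_nonneg (by simp only [hg]; positivity)]
    simp only [hg]
    rw [div_le_iff₀ hrp]
    refine (mul_le_mul_of_nonneg_right hq (by positivity)).trans (le_of_eq ?_)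
    field_simp
  · exact Continuous.intervalIntegrable (by fun_prop) _ _
  · refine Eventually.of_forall fun y hy => ?_
    rw [Set.uIoc_of_le hx.le] at hy
    have hy0 := hy.1
    have hy2 : y ^ 2 < 1 / 2 := lt_of_le_of_lt (pow_le_pow_left₀ hy0.le hy.2 2) hx2
    have h := (tendsto_logDeriv_triFreeSum hy0 hy2).mul_const (1 / y + 2 * y)
    have he : y / 2 * (1 / y + 2 * y) = 1 / 2 + y ^ 2 := by field_simp
    rw [he] at h
    refine h.congr fun n => ?_
    simp only [hg]
    have hexp := Real.exp_pos (y ^ 2)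
    field_simp

lemma log_factorial_le {k : ℕ} (hk : 1 ≤ k) :
    Real.log k.factorial ≤ 1 + Real.log k + k * Real.log k - k := by
  induction k, hk using Nat.le_induction with
  | base => simp
  | succ k hk ih =>
    have hk0 : (0 : ℝ) < k := by exact_mod_cast hk
    rw [Nat.factorial_succ, Nat.cast_mul, Real.log_mul (by positivity) (by positivity)]
    have h := Real.log_le_sub_one_of_pos (x := (k : ℝ) / (k + 1)) (by positivity)
    rw [Real.log_div (by positivity) (by positivity)] at h
    have h2 : (k : ℝ) / (k + 1) - 1 = -(1 / (k + 1)) := by field_simp; ring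
    rw [h2] at h
    have h3 := mul_le_mul_of_nonneg_left h (by positivity : (0 : ℝ) ≤ k + 1)
    have h4 : ((k : ℝ) + 1) * -(1 / (k + 1)) = -1 := by field_simp
    push_cast
    nlinarith

lemma le_log_choose {N k : ℕ} (hk : 1 ≤ k) (hkN : k ≤ N) :
    k * Real.log ((N + 1 - k) / k) + k - 1 - Real.log k ≤ Real.log (N.choose k) := by
  have hk0 : (0 : ℝ) < k := by exact_mod_cast hk
  have hN : (0 : ℝ) < N + 1 - k := by
    have : (k : ℝ) ≤ N := by exact_mod_cast hkN
    linarith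
  have h1 : ((N : ℝ) + 1 - k) ^ k ≤ k.factorial * N.choose k := by
    have h := Nat.pow_sub_le_descFactorial N k
    rw [Nat.descFactorial_eq_factorial_mul_choose] at h
    have h' : (((N + 1 - k : ℕ) : ℝ)) ^ k ≤ k.factorial * N.choose k := by exact_mod_cast h
    rwa [Nat.cast_sub (by omega), Nat.cast_add, Nat.cast_one] at h'
  have hC : (0 : ℝ) < N.choose k := by exact_mod_cast Nat.choose_pos hkN
  have h2 := Real.log_le_log (pow_pos hN k) h1
  rw [Real.log_pow, Real.log_mul (by positivity) hC.ne'] at h2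
  rw [Real.log_div hN.ne' hk0.ne']
  linarith [log_factorial_le hk]

/-- Triangle-free graphs with at most `m`, between `m` and `K`, and at least `K` edges are
counted by comparison with the weights `lam0`, `lam1` and `lam2` respectively. -/
lemma triFreeSum_le_add_add (n m K : ℕ) {lam lam0 lam1 lam2 : ℝ} (h0 : 0 < lam0) (h1 : 0 < lam1)
    (h0' : lam0 ≤ lam) (h1' : lam1 ≤ lam) (h2' : lam ≤ lam2) :
    triFreeSum n lam ≤ (lam / lam0) ^ m * triFreeSum n lam0 +
      (lam / lam2) ^ K * triFreeSum n lam2 +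
      triFreeCount n m / (n.choose 2).choose m * ((1 + lam1) ^ n.choose 2 * (lam / lam1) ^ K) := by
  have hl : 0 < lam := h0.trans_le h0'
  have h2 : 0 < lam2 := hl.trans_le h2'
  rw [add_comm 1 lam1, add_pow]
  unfold triFreeSum
  simp only [one_pow, mul_one, Finset.mul_sum, Finset.sum_mul]
  rw [← Finset.sum_add_distrib, ← Finset.sum_add_distrib]
  refine Finset.sum_le_sum fun k hk => ?_
  have hkN : k ≤ n.choose 2 := by simpa [Nat.lt_succ_iff] using hk
  have e0 : lam ^ k = (lam / lam0) ^ k * lam0 ^ k := by rw [← mul_pow, div_mul_cancel₀ _ h0.ne']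
  have e1 : lam ^ k = (lam / lam1) ^ k * lam1 ^ k := by rw [← mul_pow, div_mul_cancel₀ _ h1.ne']
  have e2 : lam ^ k = (lam / lam2) ^ k * lam2 ^ k := by rw [← mul_pow, div_mul_cancel₀ _ h2.ne']
  have p0 : 0 ≤ (lam / lam0) ^ m * (triFreeCount n k * lam0 ^ k) := by positivity
  have p1 : 0 ≤ (triFreeCount n m : ℝ) / (n.choose 2).choose m *
    (lam1 ^ k * (n.choose 2).choose k * (lam / lam1) ^ K) := by positivity
  have p2 : 0 ≤ (lam / lam2) ^ K * (triFreeCount n k * lam2 ^ k) := by positivity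
  rcases le_total k m with hkm | hkm
  · have : (lam / lam0) ^ k ≤ (lam / lam0) ^ m :=
      pow_le_pow_right₀ ((one_le_div h0).mpr h0') hkm
    have : triFreeCount n k * lam ^ k ≤ (lam / lam0) ^ m * (triFreeCount n k * lam0 ^ k) := by
      rw [e0, mul_left_comm]
      gcongr
    linarith
  rcases le_total K k with hKk | hKk
  · have : (lam / lam2) ^ k ≤ (lam / lam2) ^ K :=
      pow_le_pow_of_le_one (by positivity) ((div_le_one h2).mpr h2') hKk
    have : triFreeCount n k * lam ^ k ≤ (lam / lam2) ^ K * (triFreeCount n k * lam2 ^ k) := by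
      rw [e2, mul_left_comm]
      gcongr
    linarith
  · have h3 := triFreeCount_div_choose_anti n hkm
    have hC : (0 : ℝ) < (n.choose 2).choose k := by exact_mod_cast Nat.choose_pos hkN
    rw [div_le_iff₀ hC] at h3
    have : (lam / lam1) ^ k ≤ (lam / lam1) ^ K :=
      pow_le_pow_right₀ ((one_le_div h1).mpr h1') hKk
    have : triFreeCount n k * lam ^ k ≤ (triFreeCount n m : ℝ) / (n.choose 2).choose m *
        (lam1 ^ k * (n.choose 2).choose k * (lam / lam1) ^ K) := by
      rw [e1]
      calc (triFreeCount n k : ℝ) * ((lam / lam1) ^ k * lam1 ^ k)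
          ≤ ((triFreeCount n m : ℝ) / (n.choose 2).choose m * (n.choose 2).choose k) *
            ((lam / lam1) ^ K * lam1 ^ k) := by gcongr
        _ = _ := by ring
    linarith

lemma triFreeCount_mul_pow_le (n k : ℕ) {lam : ℝ} (hlam : 0 ≤ lam) (hk : k ≤ n.choose 2) :
    triFreeCount n k * lam ^ k ≤ triFreeSum n lam :=
  Finset.single_le_sum (f := fun k => (triFreeCount n k : ℝ) * lam ^ k)
    (fun _ _ => by positivity) (Finset.mem_range.mpr (Nat.lt_succ_of_le hk))

/-- The exponent governing the comparison of the weights at `x` and `y`. -/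
lemma comparison_exponent_neg {x y : ℝ} (hx : 0 < x) (hy : 0 < y) (hxy : x ≠ y) :
    y / 2 * (Real.log x + x ^ 2 - (Real.log y + y ^ 2)) + (y / 2 + y ^ 3 / 3) -
      (x / 2 + x ^ 3 / 3) < 0 := by
  have h := Real.log_lt_sub_one_of_pos (div_pos hx hy) (by
    rw [ne_eq, div_eq_one_iff_eq hy.ne']; exact hxy)
  rw [Real.log_div hx.ne' hy.ne'] at h
  have h1 := mul_lt_mul_of_pos_left h (half_pos hy)
  have h2 : y / 2 * (x / y - 1) = (x - y) / 2 := by field_simp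
  rw [h2] at h1
  nlinarith [mul_nonneg (sq_nonneg (x - y)) (by positivity : 0 ≤ 2 * x + y)]

lemma log_mul_exp_sq_div_sqrt {x : ℝ} (hx : 0 < x) {n : ℕ} (hn : 0 < n) :
    Real.log (x * Real.exp (x ^ 2) / √n) = Real.log (x / √n) + x ^ 2 := by
  have : 0 < √(n : ℝ) := Real.sqrt_pos.mpr (by exact_mod_cast hn)
  rw [mul_div_right_comm, Real.log_mul (by positivity) (Real.exp_pos _).ne', Real.log_exp]

/-- Graphs with about `y / 2 * n ^ (3 / 2)` edges do not contribute to the generating function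
at the weight corresponding to `x`. -/
lemma eventually_comparison_le {x y : ℝ} (hx : 0 < x) (hx2 : x ^ 2 < 1 / 2) (hy : 0 < y)
    (hy2 : y ^ 2 < 1 / 2) (hxy : x ≠ y) {k : ℕ → ℕ}
    (hk : Tendsto (fun n : ℕ => (k n : ℝ) / (n : ℝ) ^ ((3 : ℝ) / 2)) atTop (nhds (y / 2))) :
    ∀ᶠ n : ℕ in atTop, (x * Real.exp (x ^ 2) / √n / (y * Real.exp (y ^ 2) / √n)) ^ k n *
      triFreeSum n (y * Real.exp (y ^ 2) / √n) ≤
        triFreeSum n (x * Real.exp (x ^ 2) / √n) / 3 := by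
  have h1 := ((hk.mul_const (Real.log x + x ^ 2 - (Real.log y + y ^ 2))).add
    (tendsto_log_triFreeSum hy hy2)).sub (tendsto_log_triFreeSum hx hx2)
  have h2 := h1.neg_mul_atTop (comparison_exponent_neg hx hy hxy) tendsto_natCast_rpow_atTop
  filter_upwards [h2.eventually_le_atBot (-Real.log 3), eventually_gt_atTop 0] with n h hn
  have hn0 : (0 : ℝ) < n := by exact_mod_cast hn
  have hs : 0 < √(n : ℝ) := Real.sqrt_pos.mpr hn0
  have hrp : 0 < (n : ℝ) ^ ((3 : ℝ) / 2) := Real.rpow_pos_of_pos hn0 _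
  have hZ : ∀ z : ℝ, 0 < z → 0 < triFreeSum n (z * Real.exp (z ^ 2) / √n) := fun z hz =>
    zero_lt_one.trans_le (one_le_triFreeSum n (by positivity))
  have hZx := hZ x hx
  have hZy := hZ y hy
  rw [← Real.log_le_log_iff (by positivity) (by positivity), Real.log_mul (by positivity) hZy.ne',
    Real.log_pow, Real.log_div hZx.ne' (by norm_num), Real.log_div (by positivity) (by positivity),
    log_mul_exp_sq_div_sqrt hx hn, log_mul_exp_sq_div_sqrt hy hn, Real.log_div hx.ne' hs.ne',
    Real.log_div hy.ne' hs.ne']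
  have h3 : ∀ a b c d : ℝ, (a / (n : ℝ) ^ ((3 : ℝ) / 2) * b + c / (n : ℝ) ^ ((3 : ℝ) / 2) -
      d / (n : ℝ) ^ ((3 : ℝ) / 2)) * (n : ℝ) ^ ((3 : ℝ) / 2) = a * b + c - d := by
    intro a b c d
    field_simp
  rw [h3] at h
  linarith

section EdgeSequence

variable {b : ℝ} {m : ℕ → ℕ}

lemma tendsto_div_sq_zero
    (hm : Tendsto (fun n : ℕ => (m n : ℝ) / (n : ℝ) ^ ((3 : ℝ) / 2)) atTop (nhds (b / 2))) :
    Tendsto (fun n : ℕ => (m n : ℝ) / (n : ℝ) ^ 2) atTop (nhds 0) := by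
  have h : Tendsto (fun n : ℕ => (√(n : ℝ))⁻¹) atTop (nhds 0) :=
    tendsto_inv_atTop_zero.comp (Real.tendsto_sqrt_atTop.comp tendsto_natCast_atTop_atTop)
  have h2 := hm.mul h
  rw [mul_zero] at h2
  refine h2.congr' ?_
  filter_upwards [eventually_gt_atTop 0] with n hn
  have hn0 : (0 : ℝ) < n := by exact_mod_cast hn
  have hs : 0 < √(n : ℝ) := Real.sqrt_pos.mpr hn0
  rw [← sqrt_mul_rpow hn0]
  field_simp

lemma eventually_le_choose_two
    (hm : Tendsto (fun n : ℕ => (m n : ℝ) / (n : ℝ) ^ ((3 : ℝ) / 2)) atTop (nhds (b / 2))) :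
    ∀ᶠ n in atTop, m n ≤ n.choose 2 := by
  filter_upwards [(tendsto_div_sq_zero hm).eventually_lt tendsto_choose_two_div (by norm_num),
    eventually_gt_atTop 0] with n h hn
  have hn0 : (0 : ℝ) < n := by exact_mod_cast hn
  rw [div_lt_div_iff_of_pos_right (by positivity)] at h
  exact_mod_cast h.le

lemma tendsto_atTop_of_div (hb : 0 < b)
    (hm : Tendsto (fun n : ℕ => (m n : ℝ) / (n : ℝ) ^ ((3 : ℝ) / 2)) atTop (nhds (b / 2))) :
    Tendsto m atTop atTop := by
  rw [← tendsto_natCast_atTop_iff (R := ℝ)]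
  refine (hm.pos_mul_atTop (half_pos hb) tendsto_natCast_rpow_atTop).congr' ?_
  filter_upwards [eventually_gt_atTop 0] with n hn
  have hn0 : (0 : ℝ) < n := by exact_mod_cast hn
  exact div_mul_cancel₀ _ (Real.rpow_pos_of_pos hn0 _).ne'

lemma tendsto_log_div_zero (hb : 0 < b)
    (hm : Tendsto (fun n : ℕ => (m n : ℝ) / (n : ℝ) ^ ((3 : ℝ) / 2)) atTop (nhds (b / 2))) :
    Tendsto (fun n : ℕ => Real.log (m n) / (n : ℝ) ^ ((3 : ℝ) / 2)) atTop (nhds 0) := by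
  have h := (Real.isLittleO_log_id_atTop.tendsto_div_nhds_zero.comp
    (tendsto_natCast_atTop_atTop.comp (tendsto_atTop_of_div hb hm))).mul hm
  rw [zero_mul] at h
  refine h.congr' ?_
  filter_upwards [(tendsto_atTop_of_div hb hm).eventually_gt_atTop 0] with n hn
  have hm0 : (0 : ℝ) < m n := by exact_mod_cast hn
  simp only [Function.comp_apply, id]
  field_simp

lemma eventually_lt_log_choose (hb : 0 < b)
    (hm : Tendsto (fun n : ℕ => (m n : ℝ) / (n : ℝ) ^ ((3 : ℝ) / 2)) atTop (nhds (b / 2)))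
    {a : ℝ} (ha : a < b / 2) :
    ∀ᶠ n : ℕ in atTop, a < (Real.log ((n.choose 2).choose (m n)) +
      m n * Real.log (b / √n)) / (n : ℝ) ^ ((3 : ℝ) / 2) := by
  have hq : Tendsto (fun n : ℕ => ((n.choose 2 : ℝ) / (n : ℝ) ^ 2 + 1 / (n : ℝ) ^ 2 -
      m n / (n : ℝ) ^ 2) * b / (m n / (n : ℝ) ^ ((3 : ℝ) / 2))) atTop (nhds 1) := by
    have h0 : Tendsto (fun n : ℕ => 1 / (n : ℝ) ^ 2) atTop (nhds 0) :=
      tendsto_const_nhds.div_atTop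
        ((tendsto_pow_atTop two_ne_zero).comp tendsto_natCast_atTop_atTop)
    have h := (((tendsto_choose_two_div.add h0).sub (tendsto_div_sq_zero hm)).mul_const b).div hm
      (half_pos hb).ne'
    have h1 : (1 / 2 + 0 - 0) * b / (b / 2) = 1 := by
      rw [add_zero, sub_zero, one_div_mul_eq_div, div_self (half_pos hb).ne']
    rwa [h1] at h
  have h1 : Tendsto (fun n : ℕ => 1 / (n : ℝ) ^ ((3 : ℝ) / 2)) atTop (nhds 0) :=
    tendsto_const_nhds.div_atTop tendsto_natCast_rpow_atTop
  have h := ((hm.mul ((hq.log one_ne_zero).add_const 1)).sub h1).sub (tendsto_log_div_zero hb hm)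
  rw [Real.log_one, zero_add, mul_one, sub_zero, sub_zero] at h
  filter_upwards [h.eventually_const_lt ha, eventually_le_choose_two hm,
    (tendsto_atTop_of_div hb hm).eventually_gt_atTop 0, eventually_gt_atTop 0] with n h hmN hm1 hn
  refine h.trans_le ?_
  have hn0 : (0 : ℝ) < n := by exact_mod_cast hn
  have hm0 : (0 : ℝ) < m n := by exact_mod_cast hm1
  have hs : 0 < √(n : ℝ) := Real.sqrt_pos.mpr hn0
  have hrp : 0 < (n : ℝ) ^ ((3 : ℝ) / 2) := Real.rpow_pos_of_pos hn0 _
  have hN : (0 : ℝ) < n.choose 2 + 1 - m n := by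
    have : (m n : ℝ) ≤ n.choose 2 := by exact_mod_cast hmN
    linarith
  have e : ((n.choose 2 : ℝ) / (n : ℝ) ^ 2 + 1 / (n : ℝ) ^ 2 -
      m n / (n : ℝ) ^ 2) * b / (m n / (n : ℝ) ^ ((3 : ℝ) / 2)) =
      (n.choose 2 + 1 - m n) / m n * (b / √n) := by
    rw [← sqrt_mul_rpow hn0]
    field_simp
  rw [e, Real.log_mul (by positivity) (by positivity), le_div_iff₀ hrp]
  have hC := le_log_choose hm1 hmN
  have e2 : ∀ L l : ℝ, ((m n : ℝ) / (n : ℝ) ^ ((3 : ℝ) / 2) * L - 1 / (n : ℝ) ^ ((3 : ℝ) / 2) -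
      l / (n : ℝ) ^ ((3 : ℝ) / 2)) * (n : ℝ) ^ ((3 : ℝ) / 2) = m n * L - 1 - l := by
    intro L l
    field_simp
  rw [e2]
  linarith

lemma eventually_log_prob_lt (hb : 0 < b) (hb2 : b ^ 2 < 1 / 2)
    (hm : Tendsto (fun n : ℕ => (m n : ℝ) / (n : ℝ) ^ ((3 : ℝ) / 2)) atTop (nhds (b / 2)))
    {a : ℝ} (ha : -(b ^ 3 / 6) < a) :
    ∀ᶠ n : ℕ in atTop, 0 < (triFreeCount n (m n) : ℝ) / (n.choose 2).choose (m n) →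
      Real.log ((triFreeCount n (m n) : ℝ) / (n.choose 2).choose (m n)) /
        (n : ℝ) ^ ((3 : ℝ) / 2) < a := by
  obtain ⟨d, hd, hda⟩ := exists_between (neg_lt_iff_pos_add.mp ha)
  have h := (tendsto_log_triFreeSum hb hb2).sub (hm.mul_const (b ^ 2))
  have hlt : b / 2 + b ^ 3 / 3 - b / 2 * b ^ 2 < a + b / 2 - d := by
    have : b / 2 * b ^ 2 = b ^ 3 / 2 := by ring
    linarith
  filter_upwards [h.eventually_lt_const hlt, eventually_lt_log_choose hb hm
    (sub_lt_self (b / 2) hd), eventually_le_choose_two hm, eventually_gt_atTop 0]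
    with n h1 h2 hmN hn hP
  have hn0 : (0 : ℝ) < n := by exact_mod_cast hn
  have hs : 0 < √(n : ℝ) := Real.sqrt_pos.mpr hn0
  have hrp : 0 < (n : ℝ) ^ ((3 : ℝ) / 2) := Real.rpow_pos_of_pos hn0 _
  have hC : (0 : ℝ) < (n.choose 2).choose (m n) := by exact_mod_cast Nat.choose_pos hmN
  have hT : (0 : ℝ) < triFreeCount n (m n) := by rwa [div_pos_iff_of_pos_right hC] at hP
  have hlam : 0 < b * Real.exp (b ^ 2) / √n := by positivity
  have h3 := Real.log_le_log (by positivity) (triFreeCount_mul_pow_le n (m n) hlam.le hmN)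
  rw [Real.log_mul hT.ne' (by positivity), Real.log_pow, log_mul_exp_sq_div_sqrt hb hn] at h3
  rw [Real.log_div hT.ne' hC.ne', div_lt_iff₀ hrp]
  rw [lt_div_iff₀ hrp] at h2
  have h4 := mul_lt_mul_of_pos_right h1 hrp
  have e : ∀ L : ℝ, (L / (n : ℝ) ^ ((3 : ℝ) / 2) - m n / (n : ℝ) ^ ((3 : ℝ) / 2) * b ^ 2) *
      (n : ℝ) ^ ((3 : ℝ) / 2) = L - m n * b ^ 2 := by
    intro L
    field_simp
  rw [e] at h4
  nlinarith

lemma eventually_lt_log_prob_of_lt_of_lt (hb : 0 < b) {x y : ℝ} (hbx : b < x) (hxy : x < y)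
    (hy2 : y ^ 2 < 1 / 2)
    (hm : Tendsto (fun n : ℕ => (m n : ℝ) / (n : ℝ) ^ ((3 : ℝ) / 2)) atTop (nhds (b / 2)))
    {a : ℝ} (ha : a < x ^ 3 / 3 - x ^ 2 * y / 2) :
    ∀ᶠ n : ℕ in atTop, 0 < (triFreeCount n (m n) : ℝ) / (n.choose 2).choose (m n) ∧
      a < Real.log ((triFreeCount n (m n) : ℝ) / (n.choose 2).choose (m n)) /
        (n : ℝ) ^ ((3 : ℝ) / 2) := by
  have hx := hb.trans hbx
  have hy := hx.trans hxy
  have hx2 : x ^ 2 < 1 / 2 := (pow_lt_pow_left₀ hxy hx.le two_ne_zero).trans hy2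
  have hb2 : b ^ 2 < 1 / 2 := (pow_lt_pow_left₀ hbx hb.le two_ne_zero).trans hx2
  have hmono : ∀ {u v : ℝ}, 0 < u → u < v → u * Real.exp (u ^ 2) ≤ v * Real.exp (v ^ 2) := by
    intro u v hu huv
    have := hu.trans huv
    gcongr
  set K : ℕ → ℕ := fun n => ⌈y / 2 * (n : ℝ) ^ ((3 : ℝ) / 2)⌉₊
  have hK : Tendsto (fun n : ℕ => (K n : ℝ) / (n : ℝ) ^ ((3 : ℝ) / 2)) atTop (nhds (y / 2)) :=
    (tendsto_nat_ceil_mul_div_atTop (half_pos hy).le).comp tendsto_natCast_rpow_atTop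
  have h3 : Tendsto (fun n : ℕ => Real.log 3 / (n : ℝ) ^ ((3 : ℝ) / 2)) atTop (nhds 0) :=
    tendsto_const_nhds.div_atTop tendsto_natCast_rpow_atTop
  have h := (((tendsto_log_triFreeSum hx hx2).sub h3).sub_const (x / 2)).sub
    (hK.mul_const (x ^ 2))
  have hlt : a < x / 2 + x ^ 3 / 3 - 0 - x / 2 - y / 2 * x ^ 2 := by linarith
  filter_upwards [h.eventually_const_lt hlt, eventually_comparison_le hx hx2 hb hb2 hbx.ne' hm,
    eventually_comparison_le hx hx2 hy hy2 hxy.ne hK, eventually_gt_atTop 0] with n h hb' hy' hn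
  have hn0 : (0 : ℝ) < n := by exact_mod_cast hn
  have hs : 0 < √(n : ℝ) := Real.sqrt_pos.mpr hn0
  have hrp : 0 < (n : ℝ) ^ ((3 : ℝ) / 2) := Real.rpow_pos_of_pos hn0 _
  have hZ : 0 < triFreeSum n (x * Real.exp (x ^ 2) / √n) :=
    zero_lt_one.trans_le (one_le_triFreeSum n (by positivity))
  have hexp : (1 : ℝ) ≤ Real.exp (x ^ 2) := Real.one_le_exp (sq_nonneg x)
  have hsum := triFreeSum_le_add_add n (m n) (K n) (lam := x * Real.exp (x ^ 2) / √n)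
    (lam0 := b * Real.exp (b ^ 2) / √n) (lam1 := x / √n) (lam2 := y * Real.exp (y ^ 2) / √n)
    (by positivity) (by positivity)
    (div_le_div_of_nonneg_right (hmono hb hbx) hs.le)
    (div_le_div_of_nonneg_right (le_mul_of_one_le_right hx.le hexp) hs.le)
    (div_le_div_of_nonneg_right (hmono hx hxy) hs.le)
  have hratio : x * Real.exp (x ^ 2) / √n / (x / √n) = Real.exp (x ^ 2) := by field_simp
  rw [hratio] at hsum
  set P : ℝ := (triFreeCount n (m n) : ℝ) / (n.choose 2).choose (m n)
  set Z := triFreeSum n (x * Real.exp (x ^ 2) / √n)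
  have hPZ : Z / 3 ≤ P * ((1 + x / √n) ^ n.choose 2 * Real.exp (x ^ 2) ^ K n) := by linarith
  have hP : 0 < P := by
    by_contra hneg
    have h1 : P * ((1 + x / √n) ^ n.choose 2 * Real.exp (x ^ 2) ^ K n) ≤ 0 :=
      mul_nonpos_of_nonpos_of_nonneg (not_lt.mp hneg) (by positivity)
    linarith
  refine ⟨hP, ?_⟩
  have hlog := Real.log_le_log (by positivity) hPZ
  have h1x : 0 < 1 + x / √n := by positivity
  rw [Real.log_div hZ.ne' (by norm_num), Real.log_mul hP.ne' (by positivity),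
    Real.log_mul (by positivity) (by positivity), Real.log_pow, Real.log_pow, Real.log_exp] at hlog
  have hN : n.choose 2 * Real.log (1 + x / √n) ≤ x / 2 * (n : ℝ) ^ ((3 : ℝ) / 2) := by
    have h1 := Real.log_le_sub_one_of_pos h1x
    calc (n.choose 2 : ℝ) * Real.log (1 + x / √n) ≤ (n : ℝ) ^ 2 / 2 * (x / √n) :=
          mul_le_mul (choose_two_le n) (by linarith)
            (Real.log_nonneg (by linarith [div_pos hx hs])) (by positivity)
      _ = x / 2 * (n : ℝ) ^ ((3 : ℝ) / 2) := by
          rw [← sqrt_mul_rpow hn0]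
          field_simp
  rw [lt_div_iff₀ hrp]
  have h4 := mul_lt_mul_of_pos_right h hrp
  have e : ∀ A B C : ℝ, (A / (n : ℝ) ^ ((3 : ℝ) / 2) - B / (n : ℝ) ^ ((3 : ℝ) / 2) - x / 2 -
      C / (n : ℝ) ^ ((3 : ℝ) / 2) * x ^ 2) * (n : ℝ) ^ ((3 : ℝ) / 2) =
      A - B - x / 2 * (n : ℝ) ^ ((3 : ℝ) / 2) - C * x ^ 2 := by
    intro A B C
    field_simp
  rw [e] at h4
  linarith

lemma eventually_lt_log_prob (hb : 0 < b) (hb2 : b ^ 2 < 1 / 2)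
    (hm : Tendsto (fun n : ℕ => (m n : ℝ) / (n : ℝ) ^ ((3 : ℝ) / 2)) atTop (nhds (b / 2)))
    {a : ℝ} (ha : a < -(b ^ 3 / 6)) :
    ∀ᶠ n : ℕ in atTop, 0 < (triFreeCount n (m n) : ℝ) / (n.choose 2).choose (m n) ∧
      a < Real.log ((triFreeCount n (m n) : ℝ) / (n.choose 2).choose (m n)) /
        (n : ℝ) ^ ((3 : ℝ) / 2) := by
  have h1 : ∀ᶠ d : ℝ in nhds 0, (b + 2 * d) ^ 2 < 1 / 2 := by
    have : Continuous fun d : ℝ => (b + 2 * d) ^ 2 := by fun_prop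
    exact this.continuousAt.eventually_lt_const (by simpa using hb2)
  have h2 : ∀ᶠ d : ℝ in nhds 0, a < (b + d) ^ 3 / 3 - (b + d) ^ 2 * (b + 2 * d) / 2 := by
    have : Continuous fun d : ℝ => (b + d) ^ 3 / 3 - (b + d) ^ 2 * (b + 2 * d) / 2 := by fun_prop
    refine this.continuousAt.eventually_const_lt ?_
    simp only [add_zero, mul_zero]
    linarith
  obtain ⟨d, ⟨hd1, hd2⟩, hd⟩ :=
    (((h1.and h2).filter_mono nhdsWithin_le_nhds).and (self_mem_nhdsWithin (s := Set.Ioi 0))).exists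
  have hd : 0 < d := hd
  exact eventually_lt_log_prob_of_lt_of_lt hb (x := b + d) (y := b + 2 * d) (by linarith)
    (by linarith) hd1 hm hd2

lemma tendsto_log_prob (hb : 0 < b) (hb2 : b ^ 2 < 1 / 2)
    (hm : Tendsto (fun n : ℕ => (m n : ℝ) / (n : ℝ) ^ ((3 : ℝ) / 2)) atTop (nhds (b / 2))) :
    Tendsto (fun n : ℕ => Real.log ((triFreeCount n (m n) : ℝ) / (n.choose 2).choose (m n)) /
      (n : ℝ) ^ ((3 : ℝ) / 2)) atTop (nhds (-(b ^ 3 / 6))) := by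
  rw [tendsto_order]
  refine ⟨fun a ha => (eventually_lt_log_prob hb hb2 hm ha).mono fun n h => h.2, fun a ha => ?_⟩
  filter_upwards [eventually_lt_log_prob hb hb2 hm (sub_one_lt _),
    eventually_log_prob_lt hb hb2 hm ha] with n h1 h2
  exact h2 h1.1

end EdgeSequence

lemma lambertW_two_div_exp_one_lt {W : ℝ → ℝ} (hW : IsLambertW W) :
    W (2 / Real.exp 1) < 1 / 2 := by
  obtain ⟨-, hw, -⟩ := hW (2 / Real.exp 1) (by positivity)
  by_contra! h
  have h1 : 1 / 2 * Real.exp (1 / 2) ≤ 2 / Real.exp 1 := by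
    rw [← hw]
    gcongr
  rw [le_div_iff₀ (Real.exp_pos 1)] at h1
  have h2 : (1.6 : ℝ) ≤ Real.exp (1 / 2) := by
    have := Real.quadratic_le_exp_of_nonneg (x := 1 / 2) (by norm_num)
    linarith
  have h3 := Real.exp_one_gt_d9
  nlinarith

end Asymptotics

/-- **Corollary (triangle-free graphs with a given number of edges).** -/
theorem triangle_free_count_gnm
    (W : ℝ → ℝ) (hW : IsLambertW W)
    (b : ℝ) (hb : 0 < b) (hbW : b ^ 2 < W (2 / Real.exp 1))
    (m : ℕ → ℕ)
    (hm : Tendsto (fun n : ℕ => (m n : ℝ) / (n : ℝ) ^ ((3 : ℝ) / 2)) atTop (nhds (b / 2))) :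
    Tendsto (fun n : ℕ =>
        Real.log (gnmProb n (m n) {G | triCount G = 0}) / (n : ℝ) ^ ((3 : ℝ) / 2))
      atTop (nhds (-(b ^ 3 / 6))) ∧
    ∃ err : ℕ → ℝ,
      Tendsto (fun n : ℕ => err n / (n : ℝ) ^ ((3 : ℝ) / 2)) atTop (nhds 0) ∧
      ∀ᶠ n : ℕ in atTop,
        (triFreeCount n (m n) : ℝ) =
          ((n.choose 2).choose (m n) : ℝ) *
            Real.exp (-(4 / 3) * ((m n : ℝ) / (n : ℝ)) ^ 3 + err n) := by
  have hb2 : b ^ 2 < 1 / 2 := hbW.trans (lambertW_two_div_exp_one_lt hW)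
  have hlim := tendsto_log_prob hb hb2 hm
  refine ⟨hlim, fun n => Real.log ((triFreeCount n (m n) : ℝ) / (n.choose 2).choose (m n)) +
    4 / 3 * ((m n : ℝ) / n) ^ 3, ?_, ?_⟩
  · have h := hlim.add ((hm.pow 3).const_mul (4 / 3))
    have h0 : -(b ^ 3 / 6) + 4 / 3 * (b / 2) ^ 3 = 0 := by ring
    rw [h0] at h
    refine h.congr' ?_
    filter_upwards [eventually_gt_atTop 0] with n hn
    have hn0 : (0 : ℝ) < n := by exact_mod_cast hn
    have hrp : 0 < (n : ℝ) ^ ((3 : ℝ) / 2) := Real.rpow_pos_of_pos hn0 _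
    have hsq : ((n : ℝ) ^ ((3 : ℝ) / 2)) ^ 2 = (n : ℝ) ^ 3 := by
      rw [← Real.rpow_natCast, ← Real.rpow_mul hn0.le, ← Real.rpow_natCast]
      norm_num
    rw [add_div, add_right_inj, div_pow, div_pow, ← hsq]
    field_simp
  · filter_upwards [eventually_lt_log_prob hb hb2 hm (sub_one_lt _),
      eventually_le_choose_two hm] with n h hmN
    have hC : (0 : ℝ) < (n.choose 2).choose (m n) := by exact_mod_cast Nat.choose_pos hmN
    rw [neg_mul, neg_add_eq_sub, add_sub_cancel_right, Real.exp_log h.1, mul_div_cancel₀ _ hC.ne']
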